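/- arXiv:1511.04645 — 3 statements merged into one kernel-verified Lean document; each statement's English description precedes it below -/
import Mathlib

section
/- If A and B are amenable discrete groups, then the free product A ∗ B is weakly amenable with Cowling–Haagerup constant 1. -/
open scoped ComplexOrder
open scoped commutatorElement

/-! ## Operator-norm notions -/

/-- `φ` is completely bounded (as a Herz–Schur multiplier) with cb-norm at most `C`:
there are a Hilbert space `H` and bounded maps `α β : G → H` with
`φ (h⁻¹ * g) = ⟪α g, β h⟫` and `(sup ‖α‖) * (sup ‖β‖) ≤ C`. -/
def HasCBNormBound {G : Type} [Group G] (φ : G → ℂ) (C : ℝ) : Prop :=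
  ∃ (H : Type) (_ : NormedAddCommGroup H) (_ : InnerProductSpace ℂ H)
    (α β : G → H) (Ca Cb : ℝ),
      (∀ g, ‖α g‖ ≤ Ca) ∧ (∀ h, ‖β h‖ ≤ Cb) ∧ Ca * Cb ≤ C ∧
      ∀ g h : G, φ (h⁻¹ * g) = (inner ℂ (α g) (β h) : ℂ)

/-- A kernel `φ : G × G → ℂ` is completely bounded with cb-norm at most `C`. -/
def HasCBKernelBound {G : Type} (φ : G → G → ℂ) (C : ℝ) : Prop :=
  ∃ (H : Type) (_ : NormedAddCommGroup H) (_ : InnerProductSpace ℂ H)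
    (α β : G → H) (Ca Cb : ℝ),
      (∀ g, ‖α g‖ ≤ Ca) ∧ (∀ h, ‖β h‖ ≤ Cb) ∧ Ca * Cb ≤ C ∧
      ∀ g h : G, φ g h = (inner ℂ (α g) (β h) : ℂ)

/-- A function `φ : G → ℂ` is positive definite. -/
def IsPosDefFn {G : Type} [Group G] (φ : G → ℂ) : Prop :=
  ∀ (n : ℕ) (c : Fin n → ℂ) (x : Fin n → G),
    0 ≤ ∑ i, ∑ j, c i * (starRingEnd ℂ) (c j) * φ ((x j)⁻¹ * x i)

/-- A kernel `Ψ : G × G → ℂ` is positive definite. -/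
def IsPosDefKernel {X : Type} (Ψ : X → X → ℂ) : Prop :=
  ∀ (n : ℕ) (c : Fin n → ℂ) (x : Fin n → X),
    0 ≤ ∑ i, ∑ j, c i * (starRingEnd ℂ) (c j) * Ψ (x i) (x j)

/-- A (discrete) group is amenable iff it admits an approximate identity of finitely
supported positive definite functions; we use this characterization. -/
def AmenablePD (G : Type) [Group G] : Prop :=
  ∀ (S : Finset G) (ε : ℝ), 0 < ε →
    ∃ φ : G → ℂ, (Function.support φ).Finite ∧ IsPosDefFn φ ∧ ∀ g ∈ S, ‖φ g - 1‖ < ε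

/-- A group is weakly amenable with Cowling–Haagerup constant 1: there is a net of finitely
supported completely bounded functions converging to 1 pointwise with cb-norms with
limsup at most 1. -/
def WeaklyAmenableCH1 (G : Type) [Group G] : Prop :=
  ∀ (S : Finset G) (ε : ℝ), 0 < ε →
    ∃ φ : G → ℂ, (Function.support φ).Finite ∧ HasCBNormBound φ (1 + ε) ∧
      ∀ g ∈ S, ‖φ g - 1‖ < ε

/-! ## Graph products -/

section GraphProd

variable {V : Type} (Γ : SimpleGraph V) (G : V → Type) [∀ v, Group (G v)]

/-- The commutators `[G_v, G_w]` over the edges of `Γ`. -/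
def commRels : Set (Monoid.CoprodI G) :=
  {x | ∃ (v w : V) (a : G v) (b : G w), Γ.Adj v w ∧
    x = ⁅Monoid.CoprodI.of a, Monoid.CoprodI.of b⁆}

/-- The graph product of the groups `G v` over the graph `Γ`. -/
abbrev GraphProduct :=
  Monoid.CoprodI G ⧸ Subgroup.normalClosure (commRels Γ G)

/-- The image in the graph product of a syllable, i.e. an element of a vertex group. -/
def ofSyl (s : (v : V) × G v) : GraphProduct Γ G :=
  QuotientGroup.mk (Monoid.CoprodI.of s.2)

/-- The element of the graph product represented by a formal word of syllables. -/
def wordProd (w : List ((v : V) × G v)) : GraphProduct Γ G :=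
  (w.map (ofSyl Γ G)).prod

/-- `w` is a formal word of nontrivial syllables representing `g`. -/
def IsWordOf (w : List ((v : V) × G v)) (g : GraphProduct Γ G) : Prop :=
  (∀ s ∈ w, s.2 ≠ 1) ∧ wordProd Γ G w = g

/-- The reduced word length `|g|_r`. -/
noncomputable def redLength (g : GraphProduct Γ G) : ℕ :=
  sInf {n | ∃ w, IsWordOf Γ G w g ∧ w.length = n}

/-- `w` is a reduced word representing `g` : a representing word of nontrivial syllables
of minimal syllable length. -/
def IsReducedWordOf (w : List ((v : V) × G v)) (g : GraphProduct Γ G) : Prop :=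
  IsWordOf Γ G w g ∧ ∀ w', IsWordOf Γ G w' g → w.length ≤ w'.length

/-- `κ`: the maximal number of mutually adjacent vertices of `Γ`. -/
noncomputable def kappa : ℕ :=
  sSup {n | ∃ s : Finset V, Γ.IsNClique n s}

/-- The `d`-tail of `g`: syllables appearing among the last `d` syllables of some reduced
word representing `g`. -/
def dTail (g : GraphProduct Γ G) (d : ℕ) : Set ((v : V) × G v) :=
  {s | ∃ w, IsReducedWordOf Γ G w g ∧ s ∈ w.drop (w.length - d)}

/-- `g` begins with `G_v`. -/
def BeginsWith (g : GraphProduct Γ G) (v : V) : Prop :=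
  ∃ w s, IsReducedWordOf Γ G w g ∧ w.head? = some s ∧ s.1 = v

/-- `g` ends with `G(lk(v))`: some reduced word for `g` has last syllable in a vertex
group adjacent to `v`. -/
def EndsWithLink (g : GraphProduct Γ G) (v : V) : Prop :=
  ∃ w s, IsReducedWordOf Γ G w g ∧ w.getLast? = some s ∧ Γ.Adj s.1 v

/-- The half-space `𝔸_v` of elements beginning with `G_v`. -/
noncomputable def halfSpace (v : V) : Set (GraphProduct Γ G) :=
  {g | ∃ gv : G v, redLength Γ G (ofSyl Γ G ⟨v, gv⟩ * g) < redLength Γ G g}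

/-- Left translate `k • s` of a subset of the graph product. -/
def wallTrans (k : GraphProduct Γ G) (s : Set (GraphProduct Γ G)) : Set (GraphProduct Γ G) :=
  (fun x => k * x) '' s

/-- Two walls (given by their preferred half-spaces) cross if all four intersections of
half-spaces are nonempty. -/
def Cross {X : Type} (s t : Set X) : Prop :=
  (s ∩ t).Nonempty ∧ (s ∩ tᶜ).Nonempty ∧ (sᶜ ∩ t).Nonempty ∧ (sᶜ ∩ tᶜ).Nonempty

/-- The set of walls `𝕎 = {k𝔸_v}`. -/
noncomputable def Walls : Set (Set (GraphProduct Γ G)) :=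
  {s | ∃ (k : GraphProduct Γ G) (v : V), s = wallTrans Γ G k (halfSpace Γ G v)}

/-- The wall (pseudo)distance: the number of walls separating `x` and `y`. -/
noncomputable def wallDist (x y : GraphProduct Γ G) : ℕ :=
  {s | s ∈ Walls Γ G ∧ Xor' (x ∈ s) (y ∈ s)}.ncard

end GraphProd


/-- The image in the free product `A ∗ B` of a syllable. -/
def sylEmb (A B : Type) [Group A] [Group B] : A ⊕ B → Monoid.Coprod A B :=
  Sum.elim (fun a => Monoid.Coprod.inl a) (fun b => Monoid.Coprod.inr b)

namespace FP
open Matrix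

lemma gram_psd {X H : Type} [NormedAddCommGroup H] [InnerProductSpace ℂ H] (v : X → H)
    (M : Matrix X X ℂ) (h : ∀ x y, M x y = inner ℂ (v x) (v y)) : M.PosSemidef := by
  refine ⟨?_, fun x => ?_⟩
  · ext a b
    simp [Matrix.conjTranspose_apply, h]
  · have : (x.sum fun i xi ↦ x.sum fun j xj ↦ star xi * M i j * xj)
        = inner ℂ (x.sum fun i xi => xi • v i) (x.sum fun i xi => xi • v i) := by
      simp only [Finsupp.sum, sum_inner, inner_sum, inner_smul_left, inner_smul_right, h,
        Finset.mul_sum]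
      rw [Finset.sum_comm]
      refine Finset.sum_congr rfl fun i _ => Finset.sum_congr rfl fun j _ => ?_
      simp; ring
    rw [this]
    rw [inner_self_eq_norm_sq_to_K]
    rw [← RCLike.ofReal_pow]
    exact Complex.zero_le_real.mpr (sq_nonneg _)

lemma psd_gram {X : Type} (M : Matrix X X ℂ) (hM : M.PosSemidef) :
    ∃ (H : Type) (_ : NormedAddCommGroup H) (_ : InnerProductSpace ℂ H) (v : X → H),
      ∀ x y, M x y = inner ℂ (v x) (v y) := by
  let K : Matrix X X (ℂ →L[ℂ] ℂ) := Matrix.of fun x y => M x y • (1 : ℂ →L[ℂ] ℂ)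
  have hK : K.PosSemidef := by
    refine ((RKHS.posSemidef_tfae (𝕜 := ℂ) (V := ℂ) (K := K)).out 0 2 :).mpr ⟨?_, fun vv => ?_⟩
    · ext a b
      have := hM.1.apply a b
      simp [K, Matrix.conjTranspose_apply]
      simpa using this
    · have := hM.2 vv
      have h2 := (Complex.le_def.mp this).1
      refine le_of_le_of_eq h2 ?_
      unfold Finsupp.sum
      change Complex.re _ = Complex.re _
      congr 1
      refine Finset.sum_congr rfl fun i _ => Finset.sum_congr rfl fun j _ => ?_
      have := hM.1.apply i j
      simp only [RCLike.star_def] at this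
      simp [K]
      rw [this]; ring
  have : Fact K.PosSemidef := ⟨hK⟩
  refine ⟨RKHS.OfKernel K, inferInstance, inferInstance, fun x => RKHS.kerFun (RKHS.OfKernel K) x (1 : ℂ), fun x y => ?_⟩
  have := RKHS.kernel_inner (𝕜 := ℂ) (H := RKHS.OfKernel K) y x (1 : ℂ) (1 : ℂ)
  rw [← this, RKHS.OfKernel.kernel_ofKernel]
  have := hM.1.apply x y
  simp only [RCLike.star_def] at this
  simp [K, this]

lemma psd_rankone {X : Type} (a : X → ℂ) :
    (Matrix.of fun x y => a x * star (a y) : Matrix X X ℂ).PosSemidef :=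
  gram_psd (fun x => star (a x)) _ fun x y => by simp [mul_comm]

open Classical in
lemma psd_ind {X Y : Type} (c : X → Y) :
    (Matrix.of fun x y => if c x = c y then (1 : ℂ) else 0 : Matrix X X ℂ).PosSemidef := by
  have h : (1 : Matrix Y Y ℂ).PosSemidef := by
    refine ⟨isHermitian_one, fun x => ?_⟩
    simp only [Finsupp.sum, Matrix.one_apply]
    refine Finset.sum_nonneg fun i hi => ?_
    simp [hi]
    rw [mul_comm]
    exact mul_star_self_nonneg (x i)
  convert h.submatrix c using 1
  ext x y
  simp [Matrix.one_apply]

lemma psd_mul {X : Type} {A B : X → X → ℂ} (hA : (Matrix.of A).PosSemidef)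
    (hB : (Matrix.of B).PosSemidef) :
    (Matrix.of fun x y => A x y * B x y : Matrix X X ℂ).PosSemidef := hA.hadamard hB

lemma psd_add {X : Type} {A B : X → X → ℂ} (hA : (Matrix.of A).PosSemidef)
    (hB : (Matrix.of B).PosSemidef) :
    (Matrix.of fun x y => A x y + B x y : Matrix X X ℂ).PosSemidef := hA.add hB

lemma psd_sum {X J : Type} (s : Finset J) {A : J → X → X → ℂ} (hA : ∀ j ∈ s, (Matrix.of (A j)).PosSemidef) :
    (Matrix.of fun x y => ∑ j ∈ s, A j x y : Matrix X X ℂ).PosSemidef := by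
  have := Matrix.posSemidef_sum s hA
  convert this using 1
  ext x y
  simp [Matrix.sum_apply]

lemma psd_comap {X Y : Type} {A : X → X → ℂ} (hA : (Matrix.of A).PosSemidef) (c : Y → X) :
    (Matrix.of fun x y => A (c x) (c y) : Matrix Y Y ℂ).PosSemidef := hA.submatrix c

/-- summing over fibres -/
lemma psd_fiber {X J : Type} (s : Finset J) {P : X × J → X × J → ℂ} (hP : (Matrix.of P).PosSemidef) :
    (Matrix.of fun x y => ∑ i ∈ s, ∑ j ∈ s, P (x, i) (y, j) : Matrix X X ℂ).PosSemidef := by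
  obtain ⟨H, _, _, v, hv⟩ := psd_gram _ hP
  refine gram_psd (fun x => ∑ i ∈ s, v (x, i)) _ fun x y => ?_
  simp only [Matrix.of_apply] at hv
  simp only [sum_inner, inner_sum, Matrix.of_apply, hv]
  exact Finset.sum_comm

lemma psd_schur {X : Type} {M : X → X → ℂ} (hM : (Matrix.of M).PosSemidef) (o : X) (ho : M o o = 1) :
    (Matrix.of fun x y => M x y - M x o * M o y : Matrix X X ℂ).PosSemidef := by
  obtain ⟨H, _, _, v, hv⟩ := psd_gram _ hM
  simp only [Matrix.of_apply] at hv
  refine gram_psd (fun x => v x - (M o x) • v o) _ fun x y => ?_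
  have h2 : (starRingEnd ℂ) (M o x) = M x o := by
    rw [hv, hv, inner_conj_symm]
  simp only [Matrix.of_apply, inner_sub_left, inner_sub_right, inner_smul_left, inner_smul_right,
    ← hv, ho, h2]
  ring

lemma psd_local {X : Type} {M : X → X → ℂ}
    (h : ∀ F : Finset X, ∃ N : X → X → ℂ, (Matrix.of N).PosSemidef ∧
      ∀ x ∈ F, ∀ y ∈ F, M x y = N x y) : (Matrix.of M).PosSemidef := by
  classical
  refine ⟨?_, fun x => ?_⟩
  · ext a b
    obtain ⟨N, hN, hF⟩ := h {a, b}
    have := hN.1.apply a b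
    simp only [Matrix.of_apply] at this
    rw [Matrix.conjTranspose_apply, Matrix.of_apply, Matrix.of_apply, hF b (by simp) a (by simp),
      hF a (by simp) b (by simp), this]
  · obtain ⟨N, hN, hF⟩ := h x.support
    have := hN.2 x
    convert this using 1
    refine Finset.sum_congr rfl fun i hi => Finset.sum_congr rfl fun j hj => ?_
    simp [hF i hi j hj]

/-- from positive definite functions -/
lemma herm_of_pd {G : Type} [Group G] {φ : G → ℂ} (h : IsPosDefFn φ) (g : G) :
    φ g⁻¹ = star (φ g) := by
  have h1 := h 1 ![1] ![1]
  have h2 := h 2 ![1, 1] ![1, g]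
  have h3 := h 2 ![1, Complex.I] ![1, g]
  simp [Fin.sum_univ_two, Complex.le_def] at h1 h2 h3
  apply Complex.ext
  · simp; linarith [h3.2]
  · simp; linarith [h2.2]

lemma psd_of_pd {G : Type} [Group G] {φ : G → ℂ} (h : IsPosDefFn φ) :
    (Matrix.of fun g k => φ (k⁻¹ * g) : Matrix G G ℂ).PosSemidef := by
  refine ⟨?_, fun x => ?_⟩
  · ext a b
    rw [Matrix.conjTranspose_apply, Matrix.of_apply, Matrix.of_apply, ← herm_of_pd h]
    simp
  · have e := x.support.equivFin.symm
    have := h _ (fun i => star (x (e i))) (fun i => (e i : G))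
    convert this using 1
    simp only [Finsupp.sum]
    rw [← Finset.sum_coe_sort, ← e.sum_comp]
    refine Finset.sum_congr rfl fun i _ => ?_
    rw [← Finset.sum_coe_sort, ← e.sum_comp]
    refine Finset.sum_congr rfl fun j _ => ?_
    simp; ring
end FP
namespace FP

section words
set_option linter.unusedSectionVars false
variable {ι : Type} {G : ι → Type} [∀ i, Group (G i)]

open Classical in
/-- component -/
noncomputable def pr (i : ι) (s : Σ i, G i) : G i := if h : s.1 = i then h ▸ s.2 else 1

@[simp] lemma pr_self (i : ι) (a : G i) : pr i ⟨i, a⟩ = a := by simp [pr]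

/-- merged syllable -/
noncomputable def mrg (x y : Σ i, G i) : Σ i, G i := ⟨x.1, (pr x.1 y)⁻¹ * x.2⟩

lemma mrg_mk (i : ι) (a b : G i) : mrg ⟨i, a⟩ ⟨i, b⟩ = ⟨i, b⁻¹ * a⟩ := by simp [mrg]

lemma mrg_self (x : Σ i, G i) : mrg x x = ⟨x.1, 1⟩ := by
  obtain ⟨i, a⟩ := x
  simp [mrg_mk]

/-- inverse word -/
def invL (v : List (Σ i, G i)) : List (Σ i, G i) := (v.map fun s => ⟨s.1, s.2⁻¹⟩).reverse

open Classical in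
/-- word of `v⁻¹ u` -/
noncomputable def mix : List (Σ i, G i) → List (Σ i, G i) → List (Σ i, G i)
  | [], v => invL v
  | x :: u, [] => x :: u
  | x :: u, y :: v => if x = y then mix u v else
      if x.1 = y.1 then invL v ++ mrg x y :: u else invL (y :: v) ++ x :: u

/-- reducedness -/
def Red (u : List (Σ i, G i)) : Prop :=
  (∀ l ∈ u, l.2 ≠ 1) ∧ u.IsChain fun l l' => l.1 ≠ l'.1

/-- product -/
def prodL (u : List (Σ i, G i)) : Monoid.CoprodI G :=
  (u.map fun l => Monoid.CoprodI.of l.2).prod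

lemma prodL_append (u v : List (Σ i, G i)) : prodL (u ++ v) = prodL u * prodL v := by
  simp [prodL]

lemma prodL_cons (x : Σ i, G i) (v : List (Σ i, G i)) :
    prodL (x :: v) = Monoid.CoprodI.of x.2 * prodL v := by
  simp [prodL]

lemma invL_cons (x : Σ i, G i) (v : List (Σ i, G i)) :
    invL (x :: v) = invL v ++ [⟨x.1, x.2⁻¹⟩] := by simp [invL]

lemma prodL_invL (v : List (Σ i, G i)) : prodL (invL v) = (prodL v)⁻¹ := by
  induction v with
  | nil => simp [invL, prodL]
  | cons x v ih =>
    rw [invL_cons, prodL_append, ih, prodL_cons, prodL_cons, mul_inv_rev]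
    simp [prodL]

lemma red_invL {v : List (Σ i, G i)} (h : Red v) : Red (invL v) := by
  refine ⟨?_, ?_⟩
  · intro l hl
    simp only [invL, List.mem_reverse, List.mem_map] at hl
    obtain ⟨a, ha, rfl⟩ := hl
    simpa using h.1 a ha
  · rw [invL, List.isChain_reverse, List.isChain_map]
    exact h.2.imp fun a b hab => fun h => hab h.symm

lemma prodL_mix (u v : List (Σ i, G i)) : prodL (mix u v) = (prodL v)⁻¹ * prodL u := by
  induction u generalizing v with
  | nil => simp [mix, prodL_invL]; simp [prodL]
  | cons x u ih =>
    cases v with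
    | nil => simp [mix]; simp [prodL]
    | cons y v =>
      rw [mix]
      split_ifs with h1 h2
      · subst h1
        rw [ih, prodL_cons, prodL_cons]; group
      · obtain ⟨i, a⟩ := x
        obtain ⟨j, b⟩ := y
        obtain rfl : i = j := h2
        rw [mrg_mk, prodL_append, prodL_invL, prodL_cons, prodL_cons, prodL_cons]
        simp only [map_mul, map_inv, mul_inv_rev, mul_assoc]
      · rw [prodL_append, prodL_invL]

lemma red_tail {x : Σ i, G i} {u : List (Σ i, G i)} (h : Red (x :: u)) : Red u :=
  ⟨fun l hl => h.1 l (List.mem_cons_of_mem _ hl), h.2.tail⟩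

lemma red_mix {u v : List (Σ i, G i)} (hu : Red u) (hv : Red v) : Red (mix u v) := by
  induction u generalizing v with
  | nil => simpa [mix] using red_invL hv
  | cons x u ih =>
    cases v with
    | nil => simpa [mix] using hu
    | cons y v =>
      rw [mix]
      have hi := red_invL (red_tail hv)
      have hi2 := red_invL hv
      split_ifs with h1 h2
      · exact ih (red_tail hu) (red_tail hv)
      · obtain ⟨i, a⟩ := x
        obtain ⟨j, b⟩ := y
        obtain rfl : i = j := h2
        refine ⟨?_, ?_⟩
        · intro l hl
          simp only [List.mem_append, List.mem_cons] at hl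
          rcases hl with hl | rfl | hl
          · exact hi.1 l hl
          · rw [mrg_mk]
            intro h
            apply h1
            have h : b⁻¹ * a = 1 := h
            rw [inv_mul_eq_one] at h
            rw [h]
          · exact (red_tail hu).1 l hl
        · have h3 := hu.2
          have h4 := hi2.2
          rw [invL_cons] at h4
          rw [List.isChain_append] at h4 ⊢
          refine ⟨h4.1, ?_, ?_⟩
          · rw [List.isChain_cons] at h3 ⊢
            exact h3
          · simpa [mrg] using h4.2.2
      · refine ⟨?_, ?_⟩
        · intro l hl
          rw [List.mem_append] at hl
          rcases hl with hl | hl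
          · exact hi2.1 l hl
          · exact hu.1 l hl
        · rw [List.isChain_append]
          refine ⟨hi2.2, hu.2, ?_⟩
          rw [invL_cons]
          simp
          exact fun h => h2 h.symm

section alg
variable [DecidableEq ι] [∀ i, DecidableEq (G i)]

/-- normal form -/
def nf (g : Monoid.CoprodI G) : List (Σ i, G i) := (Monoid.CoprodI.Word.equiv g).toList

lemma nf_red (g : Monoid.CoprodI G) : Red (nf g) :=
  ⟨(Monoid.CoprodI.Word.equiv g).ne_one, (Monoid.CoprodI.Word.equiv g).chain_ne⟩

lemma prodL_nf (g : Monoid.CoprodI G) : prodL (nf g) = g :=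
  Monoid.CoprodI.Word.equiv.symm_apply_apply g

lemma nf_prodL {u : List (Σ i, G i)} (h : Red u) : nf (prodL u) = u := by
  have := Monoid.CoprodI.Word.equiv.apply_symm_apply (⟨u, h.1, h.2⟩ : Monoid.CoprodI.Word G)
  exact congrArg Monoid.CoprodI.Word.toList this

lemma nf_inv_mul (g h : Monoid.CoprodI G) : nf (h⁻¹ * g) = mix (nf g) (nf h) := by
  rw [← nf_prodL (red_mix (nf_red g) (nf_red h)), prodL_mix, prodL_nf, prodL_nf]

lemma nf_injective : Function.Injective (nf : Monoid.CoprodI G → _) := fun a b h => by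
  rw [← prodL_nf a, h, prodL_nf]
end alg

/-! multiplicative functional -/

/-- on syllables -/
def psi (φ : ∀ i, G i → ℂ) (s : Σ i, G i) : ℂ := φ s.1 s.2

/-- on words -/
def TT (φ : ∀ i, G i → ℂ) (u : List (Σ i, G i)) : ℂ := (u.map (psi φ)).prod

open Classical in
/-- compressed syllable kernel -/
noncomputable def DD (φ : ∀ i, G i → ℂ) (x y : Σ i, G i) : ℂ :=
  if x.1 = y.1 then psi φ (mrg x y) - psi φ x * star (psi φ y) else 0

lemma DD_psd [Fintype ι] {φ : ∀ i, G i → ℂ} (h : ∀ i, IsPosDefFn (φ i)) (h1 : ∀ i, φ i 1 = 1) :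
    (Matrix.of (DD φ)).PosSemidef := by
  classical
  have key : (Matrix.of fun x y : (Σ i, G i) => ∑ i : ι,
      (((if x.1 = i then (1 : ℂ) else 0) * star (if y.1 = i then (1 : ℂ) else 0)) *
      (φ i ((pr i y)⁻¹ * pr i x) - φ i (1⁻¹ * pr i x) * φ i ((pr i y)⁻¹ * 1)))).PosSemidef := by
    refine psd_sum _ fun i _ => psd_mul (psd_rankone (fun x : (Σ i, G i) => if x.1 = i then (1 : ℂ) else 0)) ?_
    exact psd_comap (psd_schur (psd_of_pd (h i)) 1 (by simp [h1])) (pr i)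
  convert key using 1
  ext x y
  obtain ⟨i, a⟩ := x
  obtain ⟨j, b⟩ := y
  simp only [Matrix.of_apply, DD]
  rw [Finset.sum_eq_single i]
  · by_cases h2 : i = j
    · subst h2
      simp [mrg, psi, herm_of_pd (h i)]
    · simp [h2, Ne.symm h2]
  · intro k _ hk
    simp [Ne.symm hk]
  · simp

open Classical in
/-- recursive kernel -/
noncomputable def KK (φ : ∀ i, G i → ℂ) : ℕ → List (Σ i, G i) → List (Σ i, G i) → ℂ
  | 0, _, _ => 0
  | _ + 1, [], _ => 0
  | _ + 1, _ :: _, [] => 0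
  | n + 1, x :: u, y :: v => (if x = y then KK φ n u v else 0) + DD φ x y * (TT φ u * star (TT φ v))

lemma KK_psd [Fintype ι] {φ : ∀ i, G i → ℂ} (h : ∀ i, IsPosDefFn (φ i)) (h1 : ∀ i, φ i 1 = 1)
    (n : ℕ) : (Matrix.of (KK φ n)).PosSemidef := by
  classical
  induction n with
  | zero =>
    convert Matrix.PosSemidef.zero using 1
    ext; simp [KK]
  | succ n ih =>
    by_cases hne : Nonempty (Σ i, G i)
    · obtain ⟨s0⟩ := hne
      have := psd_mul (psd_rankone (fun u : List (Σ i, G i) => if u = [] then (0 : ℂ) else 1))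
        (psd_add (psd_mul (psd_ind (fun u : List (Σ i, G i) => u.headD s0)) (psd_comap ih List.tail))
          (psd_mul (psd_comap (DD_psd h h1) (fun u : List (Σ i, G i) => u.headD s0))
            (psd_comap (psd_rankone (TT φ)) List.tail)))
      convert this using 1
      ext u v
      cases u <;> cases v <;> simp [KK]
      congr
    · convert Matrix.PosSemidef.zero using 1
      ext u v
      cases u with
      | nil => simp [KK]
      | cons x u => exact absurd ⟨x⟩ hne

lemma TT_cons (φ : ∀ i, G i → ℂ) (x u) : TT φ (x :: u) = psi φ x * TT φ u := by simp [TT]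
lemma TT_append (φ : ∀ i, G i → ℂ) (u v) : TT φ (u ++ v) = TT φ u * TT φ v := by simp [TT]

lemma TT_invL {φ : ∀ i, G i → ℂ} (h : ∀ i, IsPosDefFn (φ i)) (u) :
    TT φ (invL u) = star (TT φ u) := by
  induction u with
  | nil => simp [TT, invL]
  | cons x u ih =>
    rw [invL_cons, TT_append, ih, TT_cons, TT_cons]
    simp [psi, herm_of_pd (h x.1), TT, mul_comm]

lemma TT_mix {φ : ∀ i, G i → ℂ} (h : ∀ i, IsPosDefFn (φ i)) (h1 : ∀ i, φ i 1 = 1)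
    (n : ℕ) (u v) (hn : u.length ≤ n) :
    TT φ (mix u v) = TT φ u * star (TT φ v) + KK φ n u v := by
  induction u generalizing v n with
  | nil =>
    rw [mix, TT_invL h]
    cases n <;> simp [KK, TT]
  | cons x u ih =>
    obtain ⟨n, rfl⟩ : ∃ m, n = m + 1 := ⟨n - 1, by simp at hn; omega⟩
    cases v with
    | nil => simp [mix, KK, TT]
    | cons y v =>
      rw [mix, KK]
      split_ifs with h2 h3
      · subst h2
        rw [ih n v (by simpa using hn), TT_cons, TT_cons]
        have : psi φ (mrg x x) = 1 := by rw [mrg_self]; exact h1 _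
        simp only [DD, if_true, this, star_mul]
        ring
      · rw [TT_append, TT_invL h]
        simp only [TT_cons, DD, h3, if_true, star_mul]
        ring
      · rw [TT_append, TT_invL h]
        simp only [TT_cons, DD, h3, if_false, star_mul]
        ring

lemma mix_self (u : List (Σ i, G i)) : mix u u = [] := by
  induction u with
  | nil => simp [mix, invL]
  | cons x u ih => simp [mix, ih]

lemma TT_psd [Fintype ι] {φ : ∀ i, G i → ℂ} (h : ∀ i, IsPosDefFn (φ i)) (h1 : ∀ i, φ i 1 = 1) :
    (Matrix.of fun u v => TT φ (mix u v)).PosSemidef := by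
  refine psd_local fun F => ⟨fun u v => TT φ u * star (TT φ v) + KK φ (F.sup List.length) u v,
    psd_add (psd_rankone _) (KK_psd h h1 _), fun u hu v _ => TT_mix h h1 _ _ _ ?_⟩
  exact Finset.le_sup (f := List.length) hu

end words
end FP
namespace FP
section radial
variable {α : Type}

open Classical in
/-- longest common prefix length -/
noncomputable def lcp : List α → List α → ℕ
  | [], _ => 0
  | _ :: _, [] => 0
  | x :: u, y :: v => if x = y then lcp u v + 1 else 0

lemma lcp_le (u v : List α) : lcp u v ≤ u.length ∧ lcp u v ≤ v.length := by
  induction u generalizing v with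
  | nil => simp [lcp]
  | cons x u ih =>
    cases v with
    | nil => simp [lcp]
    | cons y v =>
      have := ih v
      rw [lcp]
      split_ifs <;> simp [this]

lemma take_eq_iff (u v : List α) (k : ℕ) (hu : k ≤ u.length) (hv : k ≤ v.length) :
    u.take k = v.take k ↔ k ≤ lcp u v := by
  induction u generalizing v k with
  | nil => simp at hu; simp [hu]
  | cons x u ih =>
    cases v with
    | nil => simp at hv; simp [hv]
    | cons y v =>
      cases k with
      | zero => simp
      | succ k =>
        simp only [List.length_cons, add_le_add_iff_right] at hu hv
        rw [lcp]
        split_ifs with h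
        · simp [h, ih v k hu hv]
        · simp [h]

/-- ancestors -/
def anc (u : List α) (i : ℕ) : List α × ℤ := (u.take (u.length - i), (u.length : ℤ) - i)

lemma anc_eq_iff (u v : List α) (i j : ℕ) :
    anc u i = anc v j ↔ (u.length - lcp u v ≤ i ∧ u.length - lcp u v + j = v.length - lcp u v + i) := by
  have h := lcp_le u v
  unfold anc
  rw [Prod.mk.injEq]
  constructor
  · rintro ⟨h1, h2⟩
    have e : u.length - i = v.length - j := by omega
    rw [e] at h1
    rw [take_eq_iff _ _ _ (by omega) (by omega)] at h1
    omega
  · rintro ⟨h1, h2⟩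
    refine ⟨?_, by omega⟩
    have e : u.length - i = v.length - j := by omega
    rw [e, take_eq_iff _ _ _ (by omega) (by omega)]
    omega

lemma anc_inj (u : List α) (i j : ℕ) : anc u i = anc u j ↔ i = j := by
  simp only [anc, Prod.mk.injEq]
  constructor
  · rintro ⟨_, h⟩; omega
  · rintro rfl; simp

lemma tele (N : ℕ) (f : ℕ → ℂ) (hf : ∀ k, N < k → f k = 0) (m a b : ℕ) (hm : N < a + m) :
    ∑ i ∈ Finset.range (N + 1), ∑ j ∈ Finset.range (N + 1),
      (f (i + j) - f (i + j + 2)) * (if a ≤ i ∧ a + j = b + i then (1 : ℂ) else 0) = f (a + b) := by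
  induction m generalizing a b with
  | zero =>
    rw [hf (a + b) (by omega)]
    refine Finset.sum_eq_zero fun i hi => Finset.sum_eq_zero fun j hj => ?_
    rw [if_neg, mul_zero]
    simp at hi; omega
  | succ m ih =>
    have h1 := ih (a + 1) (b + 1) (by omega)
    have h2 : ∑ i ∈ Finset.range (N + 1), ∑ j ∈ Finset.range (N + 1),
      (f (i + j) - f (i + j + 2)) * (if i = a ∧ j = b then (1 : ℂ) else 0) =
        f (a + b) - f (a + b + 2) := by
      by_cases hab : a ≤ N ∧ b ≤ N
      · rw [Finset.sum_eq_single a, Finset.sum_eq_single b]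
        · simp
        · intro j _ hj; simp [hj]
        · intro h; simp at h; omega
        · intro i _ hi; simp [hi]
        · intro h; simp at h; omega
      · rw [hf (a + b) (by omega), hf (a + b + 2) (by omega), sub_zero]
        refine Finset.sum_eq_zero fun i hi => Finset.sum_eq_zero fun j hj => ?_
        simp at hi hj
        rw [if_neg (by omega), mul_zero]
    have h3 : a + 1 + (b + 1) = a + b + 2 := by ring
    rw [h3] at h1
    have : f (a + b) = (f (a + b) - f (a + b + 2)) + f (a + b + 2) := by ring
    rw [this, ← h2, ← h1, ← Finset.sum_add_distrib]
    refine Finset.sum_congr rfl fun i _ => ?_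
    rw [← Finset.sum_add_distrib]
    refine Finset.sum_congr rfl fun j _ => ?_
    rw [← mul_add]
    congr 1
    by_cases hc : a ≤ i ∧ a + j = b + i
    · rw [if_pos hc]
      by_cases hi : i = a
      · rw [if_pos (by omega), if_neg (by omega), add_zero]
      · rw [if_neg (by omega), if_pos (by omega), zero_add]
    · rw [if_neg hc, if_neg (by omega), if_neg (by omega), add_zero]

/-- truncated geometric function -/
noncomputable def ff (r : ℝ) (N k : ℕ) : ℝ := if k ≤ N then r ^ k else 0

/-- error coefficients -/
noncomputable def ee (r : ℝ) (N k : ℕ) : ℝ := ff r N k - ff r N (k + 2) - (1 - r ^ 2) * r ^ k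

lemma ee_bound (r : ℝ) (h0 : 0 ≤ r) (h1 : r ≤ 1) (N k : ℕ) : |ee r N k| ≤ r ^ (N - 1) := by
  have hp : ∀ k, 0 ≤ r ^ k := fun k => pow_nonneg h0 k
  unfold ee ff
  have e : r ^ (k + 2) = r ^ 2 * r ^ k := by ring
  have hr2 : r ^ 2 ≤ 1 := pow_le_one₀ h0 h1
  by_cases hk : k ≤ N
  · by_cases hk2 : k + 2 ≤ N
    · rw [if_pos hk, if_pos hk2]
      have : r ^ k - r ^ (k + 2) - (1 - r ^ 2) * r ^ k = 0 := by rw [e]; ring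
      rw [this]; simpa using hp _
    · rw [if_pos hk, if_neg hk2]
      have : r ^ k - 0 - (1 - r ^ 2) * r ^ k = r ^ (k + 2) := by rw [e]; ring
      rw [this, abs_of_nonneg (hp _)]
      exact pow_le_pow_of_le_one h0 h1 (by omega)
  · rw [if_neg hk, if_neg (by omega)]
    have : (0 : ℝ) - 0 - (1 - r ^ 2) * r ^ k = -((1 - r ^ 2) * r ^ k) := by ring
    rw [this, abs_neg, abs_of_nonneg (mul_nonneg (by linarith) (hp _))]
    calc (1 - r ^ 2) * r ^ k ≤ 1 * r ^ k := by
          apply mul_le_mul_of_nonneg_right _ (hp _); nlinarith [hp 2]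
      _ = r ^ k := one_mul _
      _ ≤ _ := pow_le_pow_of_le_one h0 h1 (by omega)

/-- The radial truncated multiplier on a rooted tree. -/
lemma radial (r : ℝ) (h0 : 0 ≤ r) (h1 : r < 1) (N : ℕ) :
    ∃ Ψ : List α × Bool → List α × Bool → ℂ, (Matrix.of Ψ).PosSemidef ∧
      (∀ u v, Ψ (u, false) (v, true) =
        (ff r N (u.length + v.length - 2 * lcp u v) : ℝ)) ∧
      ∀ z, ∃ c : ℝ, Ψ z z = c ∧ c ≤ 1 + (N + 1) ^ 2 * r ^ (N - 1) := by
  classical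
  let R := Finset.range (N + 1)
  let Ψ1 : List α × Bool → List α × Bool → ℂ := fun z w => ∑ i ∈ R, ∑ j ∈ R,
    ((((Real.sqrt (1 - r ^ 2) * r ^ i : ℝ) : ℂ) * star (((Real.sqrt (1 - r ^ 2) * r ^ j : ℝ) : ℂ))) *
      (if anc z.1 i = anc w.1 j then (1 : ℂ) else 0))
  let sg : ℕ → Bool → ℂ := fun k b => if b then (Real.sqrt |ee r N k| : ℝ) else
    ((if 0 ≤ ee r N k then (1 : ℝ) else -1) * Real.sqrt |ee r N k| : ℝ)
  let Ψ2 : List α × Bool → List α × Bool → ℂ := fun z w => ∑ p ∈ R ×ˢ R,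
    (sg (p.1 + p.2) z.2 * star (sg (p.1 + p.2) w.2)) *
      (if anc z.1 (if z.2 then p.2 else p.1) = anc w.1 (if w.2 then p.2 else p.1) then (1 : ℂ) else 0)
  have hr2 : r ^ 2 < 1 := by nlinarith
  have hs : Real.sqrt (1 - r ^ 2) * Real.sqrt (1 - r ^ 2) = 1 - r ^ 2 :=
    Real.mul_self_sqrt (by linarith)
  refine ⟨fun z w => Ψ1 z w + Ψ2 z w, psd_add ?_ ?_, ?_, ?_⟩
  · exact psd_fiber R (P := fun (zi wj : (List α × Bool) × ℕ) =>
      ((((Real.sqrt (1 - r ^ 2) * r ^ zi.2 : ℝ) : ℂ) * star (((Real.sqrt (1 - r ^ 2) * r ^ wj.2 : ℝ) : ℂ))) *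
      (if anc zi.1.1 zi.2 = anc wj.1.1 wj.2 then (1 : ℂ) else 0)))
      (psd_mul (psd_rankone fun zi : (List α × Bool) × ℕ => ((Real.sqrt (1 - r ^ 2) * r ^ zi.2 : ℝ) : ℂ))
        (by convert! psd_ind fun zi : (List α × Bool) × ℕ => anc zi.1.1 zi.2))
  · refine psd_sum _ fun p _ => psd_mul (psd_rankone fun z : List α × Bool => sg (p.1 + p.2) z.2) ?_
    convert! psd_ind fun z : List α × Bool => anc z.1 (if z.2 then p.2 else p.1)
  · intro u v
    have hl := lcp_le u v
    have ht := tele N (fun k => (ff r N k : ℂ)) (fun k hk => by simp [ff, Nat.not_le.mpr hk])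
      (N + 1) (u.length - lcp u v) (v.length - lcp u v) (by omega)
    have e : u.length - lcp u v + (v.length - lcp u v) = u.length + v.length - 2 * lcp u v := by omega
    rw [e] at ht
    rw [← ht]
    simp only [Ψ1, Ψ2, Finset.sum_product, R]
    rw [← Finset.sum_add_distrib]
    refine Finset.sum_congr rfl fun i _ => ?_
    rw [← Finset.sum_add_distrib]
    refine Finset.sum_congr rfl fun j _ => ?_
    simp only [Bool.false_eq_true, if_false, if_true, ← anc_eq_iff]
    rw [← add_mul]
    congr 1
    have hsg : (if 0 ≤ ee r N (i + j) then (1 : ℝ) else -1) * Real.sqrt |ee r N (i + j)| * Real.sqrt |ee r N (i + j)|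
        = ee r N (i + j) := by
      rw [mul_assoc, Real.mul_self_sqrt (abs_nonneg _)]
      split_ifs with h
      · rw [abs_of_nonneg h, one_mul]
      · rw [abs_of_neg (not_le.mp h)]; ring
    simp only [sg, Bool.false_eq_true, if_false, if_true, RCLike.star_def, Complex.conj_ofReal]
    rw [← Complex.ofReal_mul, ← Complex.ofReal_mul, hsg, ← Complex.ofReal_add, ← Complex.ofReal_sub]
    congr 1
    have : √(1 - r ^ 2) * r ^ i * (√(1 - r ^ 2) * r ^ j) = (1 - r ^ 2) * r ^ (i + j) := by
      calc _ = (√(1 - r ^ 2) * √(1 - r ^ 2)) * (r ^ i * r ^ j) := by ring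
        _ = _ := by rw [hs, pow_add]
    rw [this, ee]; ring
  · intro z
    refine ⟨(∑ i ∈ R, (1 - r ^ 2) * (r ^ 2) ^ i) + ∑ p ∈ R ×ˢ R, |ee r N (p.1 + p.2)|, ?_, ?_⟩
    · have e1 : Ψ1 z z = ((∑ i ∈ R, (1 - r ^ 2) * (r ^ 2) ^ i : ℝ) : ℂ) := by
        simp only [Ψ1]
        rw [Complex.ofReal_sum]
        refine Finset.sum_congr rfl fun i hi => ?_
        rw [Finset.sum_eq_single i]
        · simp only [if_true, mul_one, RCLike.star_def, Complex.conj_ofReal]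
          rw [← Complex.ofReal_mul]
          congr 1
          calc _ = (√(1 - r ^ 2) * √(1 - r ^ 2)) * (r ^ i * r ^ i) := by ring
            _ = _ := by rw [hs]; ring
        · intro j _ hj
          rw [if_neg, mul_zero]
          rw [anc_inj]; exact hj.symm
        · exact fun h => absurd hi h
      have e2 : Ψ2 z z = ((∑ p ∈ R ×ˢ R, |ee r N (p.1 + p.2)| : ℝ) : ℂ) := by
        simp only [Ψ2]
        rw [Complex.ofReal_sum]
        refine Finset.sum_congr rfl fun p hp => ?_
        rw [if_pos trivial, mul_one]
        have hq := Real.mul_self_sqrt (abs_nonneg (ee r N (p.1 + p.2)))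
        obtain ⟨u, b⟩ := z
        cases b
        · simp only [sg, Bool.false_eq_true, if_false, RCLike.star_def, Complex.conj_ofReal]
          rw [← Complex.ofReal_mul]
          congr 1
          split_ifs
          · rw [one_mul, hq]
          · rw [neg_one_mul, neg_mul_neg, hq]
        · simp only [sg, if_true, RCLike.star_def, Complex.conj_ofReal]
          rw [← Complex.ofReal_mul, hq]
      change Ψ1 z z + Ψ2 z z = _
      rw [e1, e2, Complex.ofReal_add]
    · refine add_le_add ?_ ?_
      · rw [← Finset.mul_sum]
        have := mul_neg_geom_sum (r ^ 2) (N + 1)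
        rw [this]
        have : 0 ≤ (r ^ 2) ^ (N + 1) := by positivity
        linarith
      · refine (Finset.sum_le_card_nsmul _ _ _ fun p _ => ee_bound r h0 h1.le N _).trans ?_
        rw [Finset.card_product, nsmul_eq_mul]
        simp [R, sq]
end radial
end FP
namespace FP
section main
variable {ι : Type} {G : ι → Type} [∀ i, Group (G i)]
set_option linter.unusedSectionVars false

/-- path in the tree -/
def PP (u : List (Σ i, G i)) : List (ι ⊕ (Σ i, G i)) := u.flatMap fun s => [Sum.inl s.1, Sum.inr s]

lemma PP_cons (x : Σ i, G i) (u) : PP (x :: u) = Sum.inl x.1 :: Sum.inr x :: PP u := by simp [PP]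

lemma PP_length (u : List (Σ i, G i)) : (PP u).length = 2 * u.length := by
  induction u with
  | nil => simp [PP]
  | cons x u ih => rw [PP_cons]; simp [ih]; ring

lemma invL_length (u : List (Σ i, G i)) : (invL u).length = u.length := by simp [invL]

lemma mix_length (u v : List (Σ i, G i)) :
    (mix u v).length + lcp (PP u) (PP v) = u.length + v.length := by
  induction u generalizing v with
  | nil => simp [mix, PP, lcp, invL_length]
  | cons x u ih =>
    cases v with
    | nil => simp [mix, PP, lcp]
    | cons y v =>
      have := ih v
      rw [mix, PP_cons, PP_cons]
      by_cases h1 : x = y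
      · subst h1
        simp [lcp]; omega
      · by_cases h2 : x.1 = y.1
        · simp [lcp, h1, h2, invL_length]; omega
        · simp [lcp, h1, h2, invL_length]; omega

/-- the multiplier -/
noncomputable def mult (φ : ∀ i, G i → ℂ) (r : ℝ) (N : ℕ) (u : List (Σ i, G i)) : ℂ :=
  TT φ u * (ff r N (2 * u.length) : ℝ)

lemma mult_cb [Fintype ι] [DecidableEq ι] [∀ i, DecidableEq (G i)]
    {φ : ∀ i, G i → ℂ} (h : ∀ i, IsPosDefFn (φ i)) (h1 : ∀ i, φ i 1 = 1)
    (r : ℝ) (hr0 : 0 ≤ r) (hr1 : r < 1) (N : ℕ) {Γ : Type} [Group Γ] (e : Γ →* Monoid.CoprodI G) :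
    HasCBNormBound (fun g : Γ => mult φ r N (nf (e g))) (1 + (N + 1) ^ 2 * r ^ (N - 1)) := by
  obtain ⟨Ψ, hΨ, hoff, hd⟩ := radial (α := ι ⊕ (Σ i, G i)) r hr0 hr1 N
  have hM := psd_mul (psd_comap (TT_psd h h1) (fun z : Γ × Bool => nf (e z.1)))
    (psd_comap hΨ (fun z : Γ × Bool => (PP (nf (e z.1)), z.2)))
  obtain ⟨H, i1, i2, v, hv⟩ := psd_gram _ hM
  simp only [Matrix.of_apply] at hv
  set C : ℝ := 1 + (N + 1) ^ 2 * r ^ (N - 1) with hC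
  have hC0 : 0 ≤ C := by positivity
  have hn : ∀ z, ‖v z‖ ≤ Real.sqrt C := by
    intro z
    apply Real.le_sqrt_of_sq_le
    obtain ⟨c, hc, hcC⟩ := hd (PP (nf (e z.1)), z.2)
    have := hv z z
    rw [mix_self, hc, inner_self_eq_norm_sq_to_K] at this
    simp only [TT, List.map_nil, List.prod_nil, one_mul] at this
    have : c = ‖v z‖ ^ 2 := by
      have h9 := congrArg Complex.re this
      rw [← RCLike.ofReal_pow] at h9
      exact h9
    linarith
  refine ⟨H, i1, i2, fun g => v (g, false), fun g => v (g, true), Real.sqrt C, Real.sqrt C,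
    fun g => hn _, fun g => hn _, (Real.mul_self_sqrt hC0).le, fun g k => ?_⟩
  rw [← hv, hoff]
  change mult φ r N (nf (e (k⁻¹ * g))) = _
  unfold mult
  rw [map_mul, map_inv, nf_inv_mul]
  congr 4
  have := mix_length (nf (e g)) (nf (e k))
  rw [PP_length, PP_length]
  dsimp only
  omega

lemma lists_finite {X : Type} {F : Set X} (hF : F.Finite) (N : ℕ) :
    {l : List X | l.length ≤ N ∧ ∀ s ∈ l, s ∈ F}.Finite := by
  have : Finite F := hF
  refine ((List.finite_length_le F N).image (List.map Subtype.val)).subset ?_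
  rintro l ⟨hl, hs⟩
  refine ⟨l.attach.map fun s => ⟨s.1, hs s.1 s.2⟩, by simpa using hl, ?_⟩
  simp

lemma mult_supp [Finite ι] {φ : ∀ i, G i → ℂ} (h : ∀ i, (Function.support (φ i)).Finite)
    (r : ℝ) (N : ℕ) : (Function.support (mult φ r N)).Finite := by
  have hF : (Function.support (psi φ)).Finite := by
    have : Function.support (psi φ) = ⋃ i, (Sigma.mk i) '' (Function.support (φ i)) := by
      ext ⟨i, a⟩
      simp only [Function.mem_support, psi, Set.mem_iUnion, Set.mem_image]
      constructor
      · intro h; exact ⟨i, a, h, rfl⟩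
      · rintro ⟨j, b, hb, hj⟩
        cases hj
        exact hb
    rw [this]
    exact Set.finite_iUnion fun i => (h i).image _
  refine (lists_finite hF N).subset fun u hu => ?_
  simp only [Function.mem_support, mult, ne_eq, mul_eq_zero, not_or] at hu
  constructor
  · by_contra hlt
    apply hu.2
    rw [ff, if_neg (by omega)]; simp
  · intro s hs h0
    apply hu.1
    exact List.prod_eq_zero (List.mem_map.mpr ⟨s, hs, h0⟩)

lemma prod_close {X : Type} (l : List X) (ε : ℝ) (hε : 0 < ε) :
    ∃ δ > 0, ∀ ψ : X → ℂ, (∀ s ∈ l, ‖ψ s - 1‖ < δ) → ‖(l.map ψ).prod - 1‖ < ε := by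
  induction l generalizing ε with
  | nil => exact ⟨1, one_pos, fun ψ _ => by simpa using hε⟩
  | cons x l ih =>
    have hm : 0 < min (ε / 3) 1 := by positivity
    obtain ⟨δ, hδ, hl⟩ := ih _ hm
    refine ⟨min δ (min (ε / 3) 1), by positivity, fun ψ hψ => ?_⟩
    have h1 := hl ψ fun s hs => (hψ s (List.mem_cons_of_mem _ hs)).trans_le (min_le_left _ _)
    have h2 := (hψ x (by simp)).trans_le (min_le_right _ _)
    rw [List.map_cons, List.prod_cons]
    set a := ψ x
    set b := (l.map ψ).prod
    have e : a * b - 1 = (a - 1) * (b - 1) + (a - 1) + (b - 1) := by ring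
    rw [e]
    rw [lt_min_iff] at h1 h2
    have h3 : ‖(a - 1) * (b - 1)‖ ≤ ‖a - 1‖ := by
      rw [norm_mul]; exact mul_le_of_le_one_right (norm_nonneg _) h1.2.le
    have h4 := norm_add₃_le (a := (a - 1) * (b - 1)) (b := a - 1) (c := b - 1)
    linarith

lemma prod_close_finset {X : Type} (S : Finset (List X)) (ε : ℝ) (hε : 0 < ε) :
    ∃ δ > 0, ∀ ψ : X → ℂ, (∀ l ∈ S, ∀ s ∈ l, ‖ψ s - 1‖ < δ) →
      ∀ l ∈ S, ‖(l.map ψ).prod - 1‖ < ε := by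
  classical
  induction S using Finset.induction_on with
  | empty => exact ⟨1, one_pos, by simp⟩
  | insert l S _ ih =>
    obtain ⟨δ, hδ, h⟩ := ih
    obtain ⟨δ', hδ', h'⟩ := prod_close l ε hε
    refine ⟨min δ δ', by positivity, fun ψ hψ k hk => ?_⟩
    rw [Finset.mem_insert] at hk
    rcases hk with rfl | hk
    · exact h' ψ fun s hs => (hψ k (by simp) s hs).trans_le (min_le_right _ _)
    · exact h ψ (fun k hk s hs => (hψ k (by simp [hk]) s hs).trans_le (min_le_left _ _)) k hk

lemma amen_norm {Γ : Type} [Group Γ] (h : AmenablePD Γ) (S : Finset Γ) (ε : ℝ) (hε : 0 < ε) :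
    ∃ φ : Γ → ℂ, (Function.support φ).Finite ∧ IsPosDefFn φ ∧ φ 1 = 1 ∧ ∀ g ∈ S, ‖φ g - 1‖ < ε := by
  classical
  set δ := min (ε / 4) (1 / 2) with hδ
  have hδ0 : 0 < δ := by positivity
  obtain ⟨φ, hs, hp, hc⟩ := h (insert 1 S) δ hδ0
  have h1 := hc 1 (by simp)
  have hnn : 0 ≤ φ 1 := by simpa using hp 1 ![1] ![1]
  have hn : 1 / 2 ≤ ‖φ 1‖ := by
    have := norm_sub_norm_le (1 : ℂ) (φ 1)
    rw [norm_sub_rev, norm_one] at this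
    have := min_le_right (ε / 4) (1 / 2 : ℝ)
    linarith
  have hne : φ 1 ≠ 0 := by
    intro h0; rw [h0, norm_zero] at hn; linarith
  refine ⟨fun g => (φ 1)⁻¹ * φ g, ?_, ?_, inv_mul_cancel₀ hne, ?_⟩
  · refine hs.subset fun g hg h0 => hg ?_
    simp [h0]
  · intro n c x
    have := mul_nonneg (inv_nonneg.mpr hnn) (hp n c x)
    convert this using 1
    rw [Finset.mul_sum]
    refine Finset.sum_congr rfl fun i _ => ?_
    rw [Finset.mul_sum]
    refine Finset.sum_congr rfl fun j _ => ?_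
    ring
  · intro g hg
    have h2 := hc g (by simp [hg])
    have e : (φ 1)⁻¹ * φ g - 1 = (φ 1)⁻¹ * ((φ g - 1) - (φ 1 - 1)) := by
      field_simp; ring
    rw [e, norm_mul, norm_inv]
    have h3 : ‖φ g - 1 - (φ 1 - 1)‖ < ε / 2 := by
      have := norm_sub_le (φ g - 1) (φ 1 - 1)
      have := min_le_left (ε / 4) (1 / 2 : ℝ)
      linarith
    have h4 : ‖φ 1‖⁻¹ ≤ 2 := by
      rw [inv_le_comm₀ (by linarith) (by norm_num)]; linarith
    calc ‖φ 1‖⁻¹ * ‖φ g - 1 - (φ 1 - 1)‖ ≤ 2 * ‖φ g - 1 - (φ 1 - 1)‖ :=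
          mul_le_mul_of_nonneg_right h4 (norm_nonneg _)
      _ < ε := by linarith

lemma choose_rN (L : ℕ) (ε : ℝ) (hε : 0 < ε) : ∃ (r : ℝ) (N : ℕ), 0 ≤ r ∧ r < 1 ∧ L ≤ N ∧
    (∀ k ≤ L, 1 - r ^ k < ε) ∧ ((N : ℝ) + 1) ^ 2 * r ^ (N - 1) ≤ ε := by
  have hc : Filter.Tendsto (fun r : ℝ => r ^ L) (nhdsWithin 1 (Set.Iio 1)) (nhds 1) := by
    have : ContinuousAt (fun r : ℝ => r ^ L) 1 := by fun_prop
    have := this.tendsto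
    simp only [one_pow] at this
    exact this.mono_left nhdsWithin_le_nhds
  have h1 : ∀ᶠ r : ℝ in nhdsWithin 1 (Set.Iio 1), 1 - ε < r ^ L := hc.eventually_const_lt (by linarith)
  have h2 : ∀ᶠ r : ℝ in nhdsWithin 1 (Set.Iio 1), r < 1 := eventually_mem_nhdsWithin
  have h3 : ∀ᶠ r : ℝ in nhdsWithin 1 (Set.Iio 1), 0 < r :=
    nhdsWithin_le_nhds (eventually_gt_nhds one_pos)
  obtain ⟨r, hr1, hr2, hr3⟩ := (h1.and (h2.and h3)).exists
  have ht := tendsto_pow_const_mul_const_pow_of_abs_lt_one 2 (r := r) (by rw [abs_of_pos hr3]; exact hr2)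
  have h4 : ∀ᶠ n : ℕ in Filter.atTop, (n : ℝ) ^ 2 * r ^ n < ε * r ^ 2 := ht.eventually_lt_const (by positivity)
  obtain ⟨m, hm1, hm2⟩ := (h4.and (Filter.eventually_ge_atTop (L + 2))).exists
  obtain ⟨N, rfl⟩ : ∃ N, m = N + 2 := ⟨m - 2, by omega⟩
  refine ⟨r, N + 1, hr3.le, hr2, by omega, fun k hk => ?_, ?_⟩
  · have := pow_le_pow_of_le_one hr3.le hr2.le hk
    linarith
  · rw [pow_add, ← mul_assoc] at hm1
    have := lt_of_mul_lt_mul_right hm1 (by positivity)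
    push_cast at this ⊢
    change ((N : ℝ) + 1 + 1) ^ 2 * r ^ N ≤ ε
    have e : (N : ℝ) + 1 + 1 = N + 2 := by ring
    rw [e]; exact this.le

end main

/-- the two factors as a family -/
def Fam (A B : Type) : Bool → Type
  | true => A
  | false => B

instance famGroup (A B : Type) [Group A] [Group B] : ∀ b, Group (Fam A B b)
  | true => inferInstanceAs (Group A)
  | false => inferInstanceAs (Group B)

/-- first inclusion -/
def ofA (A B : Type) [Group A] [Group B] : A →* Monoid.CoprodI (Fam A B) :=
  Monoid.CoprodI.of (M := Fam A B) (i := true)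

/-- second inclusion -/
def ofB (A B : Type) [Group A] [Group B] : B →* Monoid.CoprodI (Fam A B) :=
  Monoid.CoprodI.of (M := Fam A B) (i := false)

/-- comparison of the binary and indexed free products -/
def toI (A B : Type) [Group A] [Group B] : Monoid.Coprod A B →* Monoid.CoprodI (Fam A B) :=
  Monoid.Coprod.lift (ofA A B) (ofB A B)

/-- inverse hom on factors -/
def fromF (A B : Type) [Group A] [Group B] : ∀ b, Fam A B b →* Monoid.Coprod A B
  | true => (Monoid.Coprod.inl : A →* Monoid.Coprod A B)
  | false => (Monoid.Coprod.inr : B →* Monoid.Coprod A B)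

lemma toI_inj (A B : Type) [Group A] [Group B] : Function.Injective (toI A B) := by
  have : (Monoid.CoprodI.lift (fromF A B)).comp (toI A B) = MonoidHom.id _ := by
    apply Monoid.Coprod.hom_ext
    · ext a
      change Monoid.CoprodI.lift (fromF A B) (toI A B (Monoid.Coprod.inl a)) = Monoid.Coprod.inl a
      rw [toI, Monoid.Coprod.lift_apply_inl]
      exact Monoid.CoprodI.lift_of (fromF A B) (i := true) a
    · ext a
      change Monoid.CoprodI.lift (fromF A B) (toI A B (Monoid.Coprod.inr a)) = Monoid.Coprod.inr a
      rw [toI, Monoid.Coprod.lift_apply_inr]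
      exact Monoid.CoprodI.lift_of (fromF A B) (i := false) a
  exact Function.LeftInverse.injective (g := Monoid.CoprodI.lift (fromF A B)) fun x => DFunLike.congr_fun this x

end FP

theorem stmt12 (A B : Type) [Group A] [Group B] (hA : AmenablePD A) (hB : AmenablePD B) :
    WeaklyAmenableCH1 (Monoid.Coprod A B) := by
  classical
  have hF : ∀ b, AmenablePD (FP.Fam A B b) := by
    intro b; cases b
    · exact hB
    · exact hA
  intro S ε hε
  let w : Monoid.Coprod A B → List (Σ b, FP.Fam A B b) := fun g => FP.nf (FP.toI A B g)
  obtain ⟨r, N, hr0, hr1, hLN, hr, hN⟩ :=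
    FP.choose_rN (S.sup fun g => 2 * (w g).length) (ε / 2) (by positivity)
  obtain ⟨δ, hδ, hclose⟩ := FP.prod_close_finset (S.image w) (ε / 2) (by positivity)
  choose φ hs hp h1 hc using fun b => FP.amen_norm (hF b)
    ((S.image w).biUnion fun l => (l.map (FP.pr b)).toFinset) δ hδ
  refine ⟨fun g => FP.mult φ r N (w g), ?_, ?_, ?_⟩
  · have := (FP.mult_supp hs r N).preimage (f := w)
      ((FP.nf_injective.comp (FP.toI_inj A B)).injOn)
    exact this
  · obtain ⟨H, i1, i2, α, β, Ca, Cb, h2, h3, h4, h5⟩ := FP.mult_cb hp h1 r hr0 hr1 N (FP.toI A B)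
    exact ⟨H, i1, i2, α, β, Ca, Cb, h2, h3, h4.trans (by linarith), h5⟩
  · intro g hg
    have hk : 2 * (w g).length ≤ S.sup fun g => 2 * (w g).length :=
      Finset.le_sup (f := fun g => 2 * (w g).length) hg
    have hT : ‖FP.TT φ (w g) - 1‖ < ε / 2 := by
      refine hclose (FP.psi φ) (fun l hl s hsl => ?_) (w g) (Finset.mem_image_of_mem _ hg)
      obtain ⟨b, a⟩ := s
      refine hc b a ?_
      rw [Finset.mem_biUnion]
      refine ⟨l, hl, ?_⟩
      rw [List.mem_toFinset, List.mem_map]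
      exact ⟨⟨b, a⟩, hsl, FP.pr_self b a⟩
    have hr' := hr _ hk
    set c : ℝ := r ^ (2 * (w g).length) with hcdef
    have hc0 : 0 ≤ c := pow_nonneg hr0 _
    have hc1 : c ≤ 1 := pow_le_one₀ hr0 hr1.le
    have hm : FP.mult φ r N (w g) = FP.TT φ (w g) * (c : ℂ) := by
      rw [FP.mult, FP.ff, if_pos (hk.trans hLN)]
    have e : FP.TT φ (w g) * (c : ℂ) - 1 = (FP.TT φ (w g) - 1) * (c : ℂ) + ((c - 1 : ℝ) : ℂ) := by
      push_cast; ring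
    change ‖FP.mult φ r N (w g) - 1‖ < ε
    rw [hm, e]
    refine (norm_add_le _ _).trans_lt ?_
    rw [norm_mul, Complex.norm_real, Complex.norm_real, Real.norm_of_nonneg hc0, Real.norm_of_nonpos (by linarith)]
    have := mul_le_of_le_one_right (norm_nonneg (FP.TT φ (w g) - 1)) hc1
    linarith
end

section
/- Let H be a complex Hilbert space, 0 < ε ≤ 1, and let x, y, z ∈ H satisfy ‖x‖² ≤ 1+ε, ‖y‖² ≤ 1+ε, ‖z‖² ≤ 1+ε and ⟨y, z⟩ = 1. Set ω := (y+z)/(2+√(2ε)) and D := √((1−‖ω‖²)/2). Then: ‖ω‖² ≤ (4+2ε)/(2+√(2ε))² (so D is a well-defined nonnegative real), ‖z−ω‖² ≤ ε, ‖y−ω‖² ≤ ε, D ≥ ε^{1/4}/4, and consequently |⟨x, z−ω⟩|/D ≤ 8ε^{1/4} and |⟨y−ω, x⟩|/D ≤ 8ε^{1/4}. -/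
open scoped ComplexOrder
open scoped commutatorElement

lemma aux_norm {H : Type} [NormedAddCommGroup H] [InnerProductSpace ℂ H] (y z : H)
    (hyz : (inner ℂ y z : ℂ) = 1) (p q : ℝ) :
    ‖p • y + q • z‖ ^ 2 = p ^ 2 * ‖y‖ ^ 2 + q ^ 2 * ‖z‖ ^ 2 + 2 * (p * q) := by
  rw [norm_add_sq (𝕜 := ℂ), ← Complex.coe_smul p y, ← Complex.coe_smul q z,
    inner_smul_left, inner_smul_right, hyz, norm_smul, norm_smul, mul_pow, mul_pow]
  simp
  ring

lemma aux_div {A D r X w ε : ℝ} (hr : 0 < r) (hr4 : r ^ 4 = ε) (h1 : ε ≤ 1) (hD : r / 4 ≤ D)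
    (hX0 : 0 ≤ X) (hw0 : 0 ≤ w)
    (hA : A ≤ X * w) (hX : X ^ 2 ≤ 1 + ε) (hw : w ^ 2 ≤ ε) : A / D ≤ 8 * r := by
  have hD0 : 0 < D := by linarith
  rw [div_le_iff₀ hD0]
  have h2 : X ≤ 2 := by nlinarith
  have h3 : w ≤ r ^ 2 := by
    apply (pow_le_pow_iff_left₀ hw0 (by positivity) two_ne_zero).1
    nlinarith
  have h4 : X * w ≤ 2 * r ^ 2 := by gcongr
  nlinarith

theorem stmt14 {H : Type} [NormedAddCommGroup H] [InnerProductSpace ℂ H]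
    (ε : ℝ) (hε : 0 < ε) (hε1 : ε ≤ 1) (x y z : H)
    (hx : ‖x‖ ^ 2 ≤ 1 + ε) (hy : ‖y‖ ^ 2 ≤ 1 + ε) (hz : ‖z‖ ^ 2 ≤ 1 + ε)
    (hyz : (inner ℂ y z : ℂ) = 1) :
    ‖(2 + Real.sqrt (2 * ε))⁻¹ • (y + z)‖ ^ 2 ≤ (4 + 2 * ε) / (2 + Real.sqrt (2 * ε)) ^ 2 ∧
    ‖z - (2 + Real.sqrt (2 * ε))⁻¹ • (y + z)‖ ^ 2 ≤ ε ∧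
    ‖y - (2 + Real.sqrt (2 * ε))⁻¹ • (y + z)‖ ^ 2 ≤ ε ∧
    ε ^ ((1 : ℝ) / 4) / 4 ≤
      Real.sqrt ((1 - ‖(2 + Real.sqrt (2 * ε))⁻¹ • (y + z)‖ ^ 2) / 2) ∧
    ‖(inner ℂ x (z - (2 + Real.sqrt (2 * ε))⁻¹ • (y + z)) : ℂ)‖ /
        Real.sqrt ((1 - ‖(2 + Real.sqrt (2 * ε))⁻¹ • (y + z)‖ ^ 2) / 2)
      ≤ 8 * ε ^ ((1 : ℝ) / 4) ∧
    ‖(inner ℂ (y - (2 + Real.sqrt (2 * ε))⁻¹ • (y + z)) x : ℂ)‖ /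
        Real.sqrt ((1 - ‖(2 + Real.sqrt (2 * ε))⁻¹ • (y + z)‖ ^ 2) / 2)
      ≤ 8 * ε ^ ((1 : ℝ) / 4) := by
  obtain ⟨r, hrdef⟩ : ∃ r, r = ε ^ ((1 : ℝ) / 4) := ⟨_, rfl⟩
  have hr : 0 < r := hrdef ▸ Real.rpow_pos_of_pos hε _
  have hr4 : r ^ 4 = ε := by
    rw [hrdef, ← Real.rpow_natCast, ← Real.rpow_mul hε.le]
    norm_num
  rw [← hrdef]
  obtain ⟨s, hs⟩ : ∃ s, s = Real.sqrt (2 * ε) := ⟨_, rfl⟩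
  have hs0 : 0 ≤ s := hs ▸ Real.sqrt_nonneg _
  have hs2 : s ^ 2 = 2 * ε := by rw [hs]; exact Real.sq_sqrt (by linarith)
  rw [← hs]
  have ht : 0 < 2 + s := by linarith
  have hsr : r ^ 2 ≤ s := by
    apply (pow_le_pow_iff_left₀ (by positivity) hs0 two_ne_zero).1
    nlinarith
  have hs2' : s ≤ 2 := by nlinarith
  have e1 : (2 + s)⁻¹ • (y + z) = (2 + s)⁻¹ • y + (2 + s)⁻¹ • z := smul_add _ _ _
  have n1 : ‖(2 + s)⁻¹ • (y + z)‖ ^ 2 ≤ (4 + 2 * ε) / (2 + s) ^ 2 := by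
    rw [e1, aux_norm y z hyz, le_div_iff₀ (by positivity)]
    field_simp
    linarith
  have e2 : z - (2 + s)⁻¹ • (y + z) = (-(2 + s)⁻¹) • y + (1 - (2 + s)⁻¹) • z := by module
  have e3 : y - (2 + s)⁻¹ • (y + z) = (1 - (2 + s)⁻¹) • y + (-(2 + s)⁻¹) • z := by module
  have key : ∀ a b : ℝ, a ≤ 1 + ε → b ≤ 1 + ε →
      (-(2 + s)⁻¹) ^ 2 * a + (1 - (2 + s)⁻¹) ^ 2 * b
        + 2 * ((-(2 + s)⁻¹) * (1 - (2 + s)⁻¹)) ≤ ε := by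
    intro a b ha hb
    have h : (-(2 + s)⁻¹) ^ 2 * a + (1 - (2 + s)⁻¹) ^ 2 * b
        + 2 * ((-(2 + s)⁻¹) * (1 - (2 + s)⁻¹))
        = (a + (1 + s) ^ 2 * b - 2 * (1 + s)) / (2 + s) ^ 2 := by
      field_simp
      ring
    rw [h, div_le_iff₀ (by positivity)]
    have : (1 + s) ^ 2 * b ≤ (1 + s) ^ 2 * (1 + ε) := by gcongr
    have : 0 ≤ ε * s := by positivity
    nlinarith
  have n2 : ‖z - (2 + s)⁻¹ • (y + z)‖ ^ 2 ≤ ε := by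
    rw [e2, aux_norm y z hyz]
    exact key _ _ hy hz
  have n3 : ‖y - (2 + s)⁻¹ • (y + z)‖ ^ 2 ≤ ε := by
    rw [e3, aux_norm y z hyz]
    have := key _ _ hz hy
    linarith
  have n4 : r / 4 ≤ Real.sqrt ((1 - ‖(2 + s)⁻¹ • (y + z)‖ ^ 2) / 2) := by
    apply Real.le_sqrt_of_sq_le
    have : (4 + 2 * ε) / (2 + s) ^ 2 ≤ 1 - r ^ 2 / 8 := by
      rw [div_le_iff₀ (by positivity)]
      have h16 : (2 + s) ^ 2 ≤ 16 := by nlinarith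
      have : r ^ 2 * (2 + s) ^ 2 ≤ s * 16 := by gcongr
      nlinarith
    nlinarith
  refine ⟨n1, n2, n3, n4, ?_, ?_⟩
  · exact aux_div hr hr4 hε1 n4 (norm_nonneg _) (norm_nonneg _) (norm_inner_le_norm _ _) hx n2
  · refine aux_div hr hr4 hε1 n4 (norm_nonneg x) (norm_nonneg _) ?_ hx n3
    rw [mul_comm]
    exact norm_inner_le_norm _ _
end

section
/- If A and B are weakly amenable discrete groups with Cowling–Haagerup constant 1, then the free product A ∗ B is weakly amenable with Cowling–Haagerup constant 1. -/
open scoped ComplexOrder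
open scoped commutatorElement

/-! ## Schur kernels -/

def SB {X : Type} (κ : X → X → ℂ) (C : ℝ) : Prop :=
  0 ≤ C ∧ ∃ (H : Type) (_ : NormedAddCommGroup H) (_ : InnerProductSpace ℂ H)
    (α β : X → H), (∀ x, ‖α x‖ ^ 2 ≤ C) ∧ (∀ x, ‖β x‖ ^ 2 ≤ C) ∧
      ∀ x y, κ x y = inner ℂ (α x) (β y)

def Gram {X : Type} (κ : X → X → ℂ) : Prop :=
  ∃ (H : Type) (_ : NormedAddCommGroup H) (_ : InnerProductSpace ℂ H)
    (α : X → H), ∀ x y, κ x y = inner ℂ (α x) (α y)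

theorem SB.of_vec {X : Type} {κ : X → X → ℂ} {H : Type} [NormedAddCommGroup H]
    [InnerProductSpace ℂ H] (α β : X → H) (a b : ℝ) (ha : 0 ≤ a) (hb : 0 ≤ b)
    (h1 : ∀ x, ‖α x‖ ≤ a) (h2 : ∀ x, ‖β x‖ ≤ b)
    (h : ∀ x y, κ x y = inner ℂ (α x) (β y)) : SB κ (a * b) := by
  refine ⟨mul_nonneg ha hb, H, inferInstance, inferInstance, ?_⟩
  rcases ha.eq_or_lt with ha | ha
  · subst ha
    refine ⟨0, 0, by simp, by simp, fun x y => ?_⟩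
    have : α x = 0 := by simpa using h1 x
    simp [h, this]
  rcases hb.eq_or_lt with hb | hb
  · subst hb
    refine ⟨0, 0, by simp, by simp, fun x y => ?_⟩
    have : β y = 0 := by simpa using h2 y
    simp [h, this]
  refine ⟨fun x => ((√(b / a) : ℝ) : ℂ) • α x, fun x => ((√(a / b) : ℝ) : ℂ) • β x, ?_, ?_, ?_⟩
  · intro x
    rw [norm_smul, mul_pow, Complex.norm_real, Real.norm_eq_abs, sq_abs, Real.sq_sqrt (by positivity)]
    have : ‖α x‖ ^ 2 ≤ a ^ 2 := by gcongr; exact h1 x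
    calc b / a * ‖α x‖ ^ 2 ≤ b / a * a ^ 2 := by gcongr
      _ = a * b := by field_simp
  · intro x
    rw [norm_smul, mul_pow, Complex.norm_real, Real.norm_eq_abs, sq_abs, Real.sq_sqrt (by positivity)]
    have : ‖β x‖ ^ 2 ≤ b ^ 2 := by gcongr; exact h2 x
    calc a / b * ‖β x‖ ^ 2 ≤ a / b * b ^ 2 := by gcongr
      _ = a * b := by field_simp
  · intro x y
    rw [inner_smul_left, inner_smul_right, h, Complex.conj_ofReal, ← mul_assoc, ← Complex.ofReal_mul,
      ← Real.sqrt_mul (by positivity)]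
    have : b / a * (a / b) = 1 := by field_simp
    simp [this]

theorem SB.mono {X : Type} {κ : X → X → ℂ} {C D : ℝ} (h : SB κ C) (hCD : C ≤ D) : SB κ D := by
  obtain ⟨h0, H, i1, i2, α, β, h1, h2, h3⟩ := h
  exact ⟨h0.trans hCD, H, i1, i2, α, β, fun x => (h1 x).trans hCD, fun x => (h2 x).trans hCD, h3⟩

theorem SB.congr {X : Type} {κ κ' : X → X → ℂ} {C : ℝ} (h : SB κ C) (e : ∀ x y, κ' x y = κ x y) :
    SB κ' C := by
  have : κ' = κ := by ext x y; exact e x y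
  rwa [this]

theorem SB.comp {X Y : Type} {κ : X → X → ℂ} {C : ℝ} (h : SB κ C) (f g : Y → X) :
    SB (fun x y => κ (f x) (g y)) C := by
  obtain ⟨h0, H, i1, i2, α, β, h1, h2, h3⟩ := h
  exact ⟨h0, H, i1, i2, α ∘ f, β ∘ g, fun x => h1 _, fun x => h2 _, fun x y => h3 _ _⟩

theorem SB.left {X : Type} {L : X → ℂ} {C : ℝ} (hC : 0 ≤ C) (h : ∀ x, ‖L x‖ ≤ C) :
    SB (fun x _ => L x) C := by
  have := SB.of_vec (κ := fun x _ => L x) (H := ℂ) (fun x => (starRingEnd ℂ) (L x)) (fun _ => 1) C 1 hC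
    zero_le_one (by simpa using h) (by simp) (by simp)
  simpa using this

theorem SB.right {X : Type} {L : X → ℂ} {C : ℝ} (hC : 0 ≤ C) (h : ∀ x, ‖L x‖ ≤ C) :
    SB (fun _ y => L y) C := by
  have := SB.of_vec (κ := fun _ y => L y) (H := ℂ) (fun _ => 1) (fun x => (L x)) 1 C
    zero_le_one hC (by simp) (by simpa using h) (by simp)
  simpa using this

theorem SB.const {X : Type} (c : ℂ) : SB (fun _ _ : X => c) ‖c‖ :=
  SB.left (norm_nonneg _) (fun _ => le_rfl)

theorem SB.add {X : Type} {κ κ' : X → X → ℂ} {C D : ℝ} (h : SB κ C) (h' : SB κ' D) :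
    SB (fun x y => κ x y + κ' x y) (C + D) := by
  obtain ⟨h0, H, i1, i2, α, β, h1, h2, h3⟩ := h
  obtain ⟨h0', H', i1', i2', α', β', h1', h2', h3'⟩ := h'
  refine ⟨add_nonneg h0 h0', WithLp 2 (H × H'), inferInstance, inferInstance,
    fun x => WithLp.toLp 2 (α x, α' x), fun x => WithLp.toLp 2 (β x, β' x), ?_, ?_, ?_⟩
  · intro x
    rw [WithLp.prod_norm_sq_eq_of_L2]
    exact add_le_add (h1 x) (h1' x)
  · intro x
    rw [WithLp.prod_norm_sq_eq_of_L2]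
    exact add_le_add (h2 x) (h2' x)
  · intro x y
    simp [h3, h3', WithLp.prod_inner_apply]

theorem SB.mul {X : Type} {κ κ' : X → X → ℂ} {C D : ℝ} (h : SB κ C) (h' : SB κ' D) :
    SB (fun x y => κ x y * κ' x y) (C * D) := by
  obtain ⟨h0, H, i1, i2, α, β, h1, h2, h3⟩ := h
  obtain ⟨h0', H', i1', i2', α', β', h1', h2', h3'⟩ := h'
  refine ⟨mul_nonneg h0 h0', TensorProduct ℂ H H', inferInstance, inferInstance,
    fun x => TensorProduct.tmul ℂ (α x) (α' x), fun x => TensorProduct.tmul ℂ (β x) (β' x), ?_, ?_, ?_⟩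
  · intro x
    rw [TensorProduct.norm_tmul, mul_pow]
    exact mul_le_mul (h1 x) (h1' x) (by positivity) h0
  · intro x
    rw [TensorProduct.norm_tmul, mul_pow]
    exact mul_le_mul (h2 x) (h2' x) (by positivity) h0
  · intro x y
    simp [h3, h3']

theorem SB.smul {X : Type} {κ : X → X → ℂ} {C : ℝ} (c : ℂ) (h : SB κ C) :
    SB (fun x y => c * κ x y) (‖c‖ * C) := (SB.const c).mul h

theorem SB.sub {X : Type} {κ κ' : X → X → ℂ} {C D : ℝ} (h : SB κ C) (h' : SB κ' D) :
    SB (fun x y => κ x y - κ' x y) (C + D) := by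
  have := h.add (h'.smul (-1))
  simp only [norm_neg, norm_one, one_mul, neg_one_mul, ← sub_eq_add_neg] at this
  exact this

theorem SB.sum {X ι : Type} (s : Finset ι) {κ : ι → X → X → ℂ} {C : ι → ℝ}
    (h : ∀ i ∈ s, SB (κ i) (C i)) : SB (fun x y => ∑ i ∈ s, κ i x y) (∑ i ∈ s, C i) := by
  classical
  induction s using Finset.induction_on with
  | empty => simpa using SB.const (X := X) 0
  | insert a s ha ih =>
    simp only [Finset.sum_insert ha]
    exact (h a (by simp)).add (ih fun i hi => h i (by simp [hi]))

theorem SB.prod {X : Type} (M : ℕ) {κ : ℕ → X → X → ℂ} {D : ℝ}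
    (h : ∀ i, SB (κ i) D) : SB (fun x y => ∏ i ∈ Finset.range M, κ i x y) (D ^ M) := by
  induction M with
  | zero => simpa using SB.const (X := X) 1
  | succ M ih =>
    simp only [Finset.prod_range_succ, pow_succ]
    exact ih.mul (h M)

theorem SB.prod_sub {X : Type} (M : ℕ) {κ κ' : ℕ → X → X → ℂ} {D δ : ℝ}
    (h : ∀ i, SB (κ i) D) (h' : ∀ i, SB (κ' i) D)
    (hd : ∀ i, SB (fun x y => κ i x y - κ' i x y) δ) :
    SB (fun x y => ∏ i ∈ Finset.range M, κ i x y - ∏ i ∈ Finset.range M, κ' i x y)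
      (M * D ^ (M - 1) * δ) := by
  induction M with
  | zero => simpa using SB.const (X := X) 0
  | succ M ih =>
    have := (ih.mul (h M)).add ((SB.prod M h').mul (hd M))
    refine (this.congr ?_).mono ?_
    · intro x y
      simp only [Finset.prod_range_succ]
      ring
    · apply le_of_eq
      rcases M with _ | M
      · simp
      · simp [pow_succ]; ring

theorem SB.norm_le {X : Type} {κ : X → X → ℂ} {C : ℝ} (h : SB κ C) (x y : X) : ‖κ x y‖ ≤ C := by
  obtain ⟨h0, H, i1, i2, α, β, h1, h2, h3⟩ := h
  rw [h3]
  refine (norm_inner_le_norm _ _).trans ?_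
  nlinarith [sq_nonneg (‖α x‖ - ‖β y‖), h1 x, h2 y]

theorem Gram.sb {X : Type} {κ : X → X → ℂ} {C : ℝ} (hC : 0 ≤ C) (h : Gram κ)
    (hd : ∀ x, ‖κ x x‖ ≤ C) : SB κ C := by
  obtain ⟨H, i1, i2, α, h3⟩ := h
  have : ∀ x, ‖α x‖ ^ 2 ≤ C := by
    intro x
    have := hd x
    rw [h3, inner_self_eq_norm_sq_to_K] at this
    simpa using this
  exact ⟨hC, H, i1, i2, α, α, this, this, h3⟩

theorem Gram.comp {X Y : Type} {κ : X → X → ℂ} (h : Gram κ) (f : Y → X) :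
    Gram (fun x y => κ (f x) (f y)) := by
  obtain ⟨H, i1, i2, α, h3⟩ := h
  exact ⟨H, i1, i2, α ∘ f, fun x y => h3 _ _⟩

theorem Gram.congr {X : Type} {κ κ' : X → X → ℂ} (h : Gram κ) (e : ∀ x y, κ' x y = κ x y) :
    Gram κ' := by
  have : κ' = κ := by ext x y; exact e x y
  rwa [this]

theorem Gram.rank_one {X : Type} (L : X → ℂ) : Gram (fun x y => L x * (starRingEnd ℂ) (L y)) :=
  ⟨ℂ, inferInstance, inferInstance, fun x => (starRingEnd ℂ) (L x), by simp [mul_comm]⟩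

theorem Gram.add {X : Type} {κ κ' : X → X → ℂ} (h : Gram κ) (h' : Gram κ') :
    Gram (fun x y => κ x y + κ' x y) := by
  obtain ⟨H, i1, i2, α, h3⟩ := h
  obtain ⟨H', i1', i2', α', h3'⟩ := h'
  refine ⟨WithLp 2 (H × H'), inferInstance, inferInstance,
    fun x => WithLp.toLp 2 (α x, α' x), ?_⟩
  intro x y
  simp [h3, h3', WithLp.prod_inner_apply]

theorem Gram.mul {X : Type} {κ κ' : X → X → ℂ} (h : Gram κ) (h' : Gram κ') :
    Gram (fun x y => κ x y * κ' x y) := by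
  obtain ⟨H, i1, i2, α, h3⟩ := h
  obtain ⟨H', i1', i2', α', h3'⟩ := h'
  refine ⟨TensorProduct ℂ H H', inferInstance, inferInstance,
    fun x => TensorProduct.tmul ℂ (α x) (α' x), ?_⟩
  intro x y
  simp [h3, h3']

theorem Gram.prod {X : Type} (M : ℕ) {κ : ℕ → X → X → ℂ}
    (h : ∀ i, Gram (κ i)) : Gram (fun x y => ∏ i ∈ Finset.range M, κ i x y) := by
  induction M with
  | zero => simpa using Gram.rank_one (X := X) (fun _ => 1)
  | succ M ih =>
    simp only [Finset.prod_range_succ]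
    exact ih.mul (h M)

open Classical in
theorem Gram.eq {X Z : Type} (f : X → Z) : Gram (fun x y => if f x = f y then (1 : ℂ) else 0) := by
  refine ⟨lp (fun _ : Z => ℂ) 2, inferInstance, inferInstance,
    fun x => lp.single 2 (f x) (1 : ℂ), fun x y => ?_⟩
  rw [lp.inner_single_left]
  simp [Pi.single_apply]

theorem Gram.weighted {X : Type} {P : X × ℕ → X × ℕ → ℂ} (h : Gram P) (c : ℕ → ℝ) (M : ℕ) :
    Gram (fun x y => ∑ k ∈ Finset.range M, ∑ l ∈ Finset.range M,
      ((c k * c l : ℝ) : ℂ) * P (x, k) (y, l)) := by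
  obtain ⟨H, i1, i2, α, h3⟩ := h
  refine ⟨H, i1, i2, fun x => ∑ k ∈ Finset.range M, ((c k : ℝ) : ℂ) • α (x, k), fun x y => ?_⟩
  simp only [sum_inner, inner_sum, inner_smul_left, inner_smul_right, h3, Complex.conj_ofReal]
  simp only [Finset.mul_sum]
  rw [Finset.sum_comm]
  refine Finset.sum_congr rfl fun k _ => Finset.sum_congr rfl fun l _ => ?_
  push_cast; ring

/-! ## Level kernels -/

section Lists

set_option linter.unusedSectionVars false

variable {ι : Type} {G : ι → Type} [∀ i, Group (G i)]

def sone (s : Σ i, G i) : Σ i, G i := ⟨s.1, 1⟩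

theorem sone_eq {s t : Σ i, G i} (h : s.1 = t.1) : sone t = sone s := by
  obtain ⟨i, a⟩ := s
  obtain ⟨j, b⟩ := t
  obtain rfl : i = j := h
  rfl

def kL (q : (Σ i, G i) → (Σ i, G i) → ℂ) (n : ℕ) (x : List (Σ i, G i)) : ℂ :=
  (x[n]?).elim 1 (fun s => q s (sone s))

def kR (q : (Σ i, G i) → (Σ i, G i) → ℂ) (n : ℕ) (x : List (Σ i, G i)) : ℂ :=
  (x[n]?).elim 1 (fun s => q (sone s) s)

def kV (n : ℕ) (x : List (Σ i, G i)) : Option (List (Σ i, G i) × ι) :=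
  (x[n]?).map fun s => (x.take n, s.1)

open Classical in
noncomputable def kW (n : ℕ) (x y : List (Σ i, G i)) : ℂ :=
  if (kV n x).isSome ∧ kV n x = kV n y then 1 else 0

def oQ (q : (Σ i, G i) → (Σ i, G i) → ℂ) (s t : Option (Σ i, G i)) : ℂ :=
  s.elim 0 fun s => t.elim 0 fun t => q s t

noncomputable def kap (q : (Σ i, G i) → (Σ i, G i) → ℂ) (n : ℕ) (x y : List (Σ i, G i)) : ℂ :=
  kL q n x * kR q n y + kW n x y * (oQ q x[n]? y[n]? - kL q n x * kR q n y)

theorem kW_gram (n : ℕ) : Gram (kW (G := G) n) := by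
  classical
  refine ((Gram.eq (kV (G := G) n)).mul
    (Gram.rank_one (fun x => if (kV (G := G) n x).isSome then (1 : ℂ) else 0))).congr fun x y => ?_
  unfold kW
  by_cases h : kV n x = kV n y
  · by_cases h2 : (kV n y).isSome <;> simp [h, h2]
  · simp [h]

theorem kW_sb (n : ℕ) : SB (kW (G := G) n) 1 := by
  classical
  refine (kW_gram n).sb zero_le_one fun x => ?_
  unfold kW
  split_ifs <;> simp

theorem oQ_sb {q : (Σ i, G i) → (Σ i, G i) → ℂ} {C : ℝ} (h : SB q C) : SB (oQ q) C := by
  obtain ⟨h0, H, i1, i2, α, β, h1, h2, h3⟩ := h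
  refine ⟨h0, H, i1, i2, fun s => s.elim 0 α, fun s => s.elim 0 β, ?_, ?_, ?_⟩
  · rintro (_ | s) <;> simp [h0, h1]
  · rintro (_ | s) <;> simp [h0, h2]
  · rintro (_ | s) (_ | t) <;> simp [oQ, h3]

theorem kL_norm {q : (Σ i, G i) → (Σ i, G i) → ℂ} (h : SB q 2) (n) (x : List (Σ i, G i)) :
    ‖kL q n x‖ ≤ 2 := by
  unfold kL
  rcases x[n]? with _ | s
  · simp
  · exact h.norm_le _ _

theorem kR_norm {q : (Σ i, G i) → (Σ i, G i) → ℂ} (h : SB q 2) (n) (x : List (Σ i, G i)) :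
    ‖kR q n x‖ ≤ 2 := by
  unfold kR
  rcases x[n]? with _ | s
  · simp
  · exact h.norm_le _ _

theorem kL_sub {q q' : (Σ i, G i) → (Σ i, G i) → ℂ} {δ : ℝ} (h : SB (fun s t => q s t - q' s t) δ)
    (n) (x : List (Σ i, G i)) : ‖kL q n x - kL q' n x‖ ≤ δ := by
  unfold kL
  rcases x[n]? with _ | s
  · simpa using h.1
  · exact h.norm_le _ _

theorem kR_sub {q q' : (Σ i, G i) → (Σ i, G i) → ℂ} {δ : ℝ} (h : SB (fun s t => q s t - q' s t) δ)
    (n) (x : List (Σ i, G i)) : ‖kR q n x - kR q' n x‖ ≤ δ := by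
  unfold kR
  rcases x[n]? with _ | s
  · simpa using h.1
  · exact h.norm_le _ _

theorem kap_sb {q : (Σ i, G i) → (Σ i, G i) → ℂ} (h : SB q 2) (n : ℕ) : SB (kap q n) 10 := by
  have h1 := (SB.left zero_le_two (kL_norm h n)).mul (SB.right zero_le_two (kR_norm h n))
  have h2 := (kW_sb (G := G) n).mul (((oQ_sb h).comp (fun x : List _ => x[n]?) (fun y => y[n]?)).sub h1)
  exact (h1.add h2).mono (by norm_num)

theorem kap_sub {q q' : (Σ i, G i) → (Σ i, G i) → ℂ} {δ : ℝ} (h : SB q 2) (h' : SB q' 2)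
    (hd : SB (fun s t => q s t - q' s t) δ) (n : ℕ) :
    SB (fun x y => kap q n x y - kap q' n x y) (9 * δ) := by
  have hδ := hd.1
  have h1 := ((SB.left hδ (kL_sub hd n)).mul (SB.right zero_le_two (kR_norm h n))).add
    ((SB.left zero_le_two (kL_norm h' n)).mul (SB.right hδ (kR_sub hd n)))
  have h2 := (kW_sb (G := G) n).mul
    (((oQ_sb hd).comp (fun x : List _ => x[n]?) (fun y => y[n]?)).sub h1)
  refine ((h1.add h2).congr fun x y => ?_).mono (by linarith)
  have : oQ (fun s t => q s t - q' s t) x[n]? y[n]? = oQ q x[n]? y[n]? - oQ q' x[n]? y[n]? := by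
    rcases x[n]? with _ | s <;> rcases y[n]? with _ | t <;> simp [oQ]
  simp only [kap, this]
  ring

theorem kap_gram {q : (Σ i, G i) → (Σ i, G i) → ℂ} {H : Type} [NormedAddCommGroup H]
    [InnerProductSpace ℂ H] (u : (Σ i, G i) → H) (hu : ∀ s, ‖u s‖ = 1)
    (hq : ∀ s t, q s t = inner ℂ (u s) (u t)) (n : ℕ) : Gram (kap q n) := by
  have hg : Gram (fun s t : Option (Σ i, G i) =>
      (inner ℂ (s.elim 0 fun s => u s - (inner ℂ (u (sone s)) (u s) : ℂ) • u (sone s))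
        (t.elim 0 fun s => u s - (inner ℂ (u (sone s)) (u s) : ℂ) • u (sone s)) : ℂ)) :=
    ⟨H, inferInstance, inferInstance, _, fun s t => rfl⟩
  have h1 := (Gram.rank_one (kL q n)).add
    ((kW_gram n).mul (hg.comp (fun x : List (Σ i, G i) => x[n]?)))
  refine h1.congr fun x y => ?_
  have hR : ∀ y, kR q n y = (starRingEnd ℂ) (kL q n y) := by
    intro y
    unfold kR kL
    rcases y[n]? with _ | s
    · simp
    · simp [hq]
  unfold kap
  rw [hR]
  congr 1
  by_cases hw : kW n x y = 0
  · simp [hw]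
  congr 1
  have hw' : (kV n x).isSome ∧ kV n x = kV n y := by
    by_contra h
    exact hw (by simp [kW, h])
  obtain ⟨hw1, hw2⟩ := hw'
  unfold kV at hw1 hw2
  unfold kL
  generalize x[n]? = os at *
  generalize y[n]? = ot at *
  rcases os with _ | s
  · simp at hw1
  rcases ot with _ | t
  · simp at hw2
  simp only [Option.map_some, Option.some.injEq, Prod.mk.injEq] at hw2
  have hst : sone t = sone s := sone_eq hw2.2
  have h11 : (inner ℂ (u (sone s)) (u (sone s)) : ℂ) = 1 := by
    rw [inner_self_eq_norm_sq_to_K, hu]; simp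
  simp only [oQ, Option.elim_some, hq, hst, inner_sub_left, inner_sub_right, inner_smul_left,
    inner_smul_right, inner_conj_symm, h11]
  ring

theorem kap_diag {q : (Σ i, G i) → (Σ i, G i) → ℂ} (hq : ∀ s, q s s = 1) (n : ℕ)
    (x : List (Σ i, G i)) : kap q n x x = 1 := by
  unfold kap kW kV kL kR oQ
  rcases x[n]? with _ | s <;> simp [hq]

end Lists

/-! ## Combinatorics of words -/

open Classical in
noncomputable def cp {α : Type} : List α → List α → ℕ
  | a :: u, b :: v => if a = b then cp u v + 1 else 0
  | _, _ => 0

theorem cp_nil_left {α : Type} (v : List α) : cp [] v = 0 := by simp [cp]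
theorem cp_nil_right {α : Type} (v : List α) : cp v [] = 0 := by cases v <;> simp [cp]

theorem cp_le_left {α : Type} (u v : List α) : cp u v ≤ u.length := by
  induction u generalizing v with
  | nil => simp [cp]
  | cons a u ih =>
    cases v with
    | nil => simp [cp]
    | cons b v =>
      rw [cp]
      split_ifs
      · simpa using ih v
      · simp

theorem cp_le_right {α : Type} (u v : List α) : cp u v ≤ v.length := by
  induction u generalizing v with
  | nil => simp [cp]
  | cons a u ih =>
    cases v with
    | nil => simp [cp]
    | cons b v =>
      rw [cp]
      split_ifs
      · simpa using ih v
      · simp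

theorem take_eq_iff {α : Type} (m : ℕ) (u v : List α) (h1 : m ≤ u.length) (h2 : m ≤ v.length) :
    u.take m = v.take m ↔ m ≤ cp u v := by
  induction m generalizing u v with
  | zero => simp
  | succ m ih =>
    cases u with
    | nil => simp at h1
    | cons a u =>
      cases v with
      | nil => simp at h2
      | cons b v =>
        rw [cp]
        simp only [List.take_succ_cons, List.cons.injEq]
        rw [ih u v (by simpa using h1) (by simpa using h2)]
        split_ifs with h
        · simp [h]
        · simp [h]

section Words

set_option linter.unusedSectionVars false

variable {ι : Type} {G : ι → Type} [∀ i, Group (G i)]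

def enc : List (Σ i, G i) → List (ι ⊕ (Σ i, G i))
  | [] => []
  | s :: x => Sum.inl s.1 :: Sum.inr s :: enc x

theorem enc_length (x : List (Σ i, G i)) : (enc x).length = 2 * x.length := by
  induction x with
  | nil => rfl
  | cons s x ih => simp [enc, ih]; omega

def anc (p : List (Σ i, G i) × ℕ) : List (ι ⊕ (Σ i, G i)) × ℤ :=
  ((enc p.1).take (2 * p.1.length - p.2), 2 * (p.1.length : ℤ) - p.2)

def suf (p : List (Σ i, G i) × ℕ) : List (Σ i, G i) := p.1.drop (p.1.length - (p.2 + 1) / 2)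

theorem anc_eq_iff (x y : List (Σ i, G i)) (k l : ℕ) :
    anc (x, k) = anc (y, l) ↔ (2 * (x.length : ℤ) - k = 2 * (y.length : ℤ) - l ∧
      2 * (x.length : ℤ) - k ≤ cp (enc x) (enc y)) := by
  simp only [anc, Prod.mk.injEq]
  rw [and_comm]
  refine and_congr_right fun h => ?_
  have e : 2 * x.length - k = 2 * y.length - l := by omega
  rw [← e, take_eq_iff _ _ _ (by rw [enc_length]; omega) (by rw [enc_length]; omega)]
  omega

theorem take_of_cp (m : ℕ) (x y : List (Σ i, G i)) (h : 2 * m ≤ cp (enc x) (enc y)) :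
    x.take m = y.take m := by
  induction m generalizing x y with
  | zero => simp
  | succ m ih =>
    cases x with
    | nil => simp [enc, cp] at h
    | cons s x =>
      cases y with
      | nil => simp [enc, cp_nil_right] at h
      | cons t y =>
        simp only [enc, cp] at h
        split_ifs at h with h1 h2
        · simp only [Sum.inr.injEq] at h2
          subst h2
          simp [ih x y (by omega)]
        · omega
        · omega

theorem suf_spec (x y : List (Σ i, G i)) (k l : ℕ) (h : anc (x, k) = anc (y, l)) :
    ∃ p, x = p ++ suf (x, k) ∧ y = p ++ suf (y, l) := by
  rw [anc_eq_iff] at h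
  refine ⟨x.take (x.length - (k + 1) / 2), by simp [suf], ?_⟩
  have e : x.length - (k + 1) / 2 = y.length - (l + 1) / 2 := by omega
  rw [take_of_cp _ x y (by omega), e]
  simp [suf]

theorem suf_length (x : List (Σ i, G i)) (k : ℕ) : (suf (x, k)).length ≤ k := by
  simp [suf]; omega

open Classical in
theorem anc_sum (x y : List (Σ i, G i)) (M : ℕ) (r : ℝ) (D : ℕ)
    (hD : D + 2 * cp (enc x) (enc y) = 2 * x.length + 2 * y.length) :
    ∑ k ∈ Finset.range M, ∑ l ∈ Finset.range M,
      (if k + l < M then (r ^ (k + l) * if anc (x, k) = anc (y, l) then 1 else 0) else 0) =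
    ∑ t ∈ Finset.range M, if D + 2 * t < M then r ^ (D + 2 * t) else 0 := by
  have hx := cp_le_left (enc x) (enc y)
  have hy := cp_le_right (enc x) (enc y)
  rw [enc_length] at hx hy
  simp only [anc_eq_iff]
  generalize cp (enc x) (enc y) = c at *
  generalize x.length = a at *
  generalize y.length = b at *
  rw [← Finset.sum_product', ← Finset.sum_filter]
  simp only [mul_ite, mul_one, mul_zero]
  rw [← Finset.sum_filter, ← Finset.sum_filter]
  refine Finset.sum_nbij' (fun p => p.1 - (2 * a - c)) (fun t => (2 * a - c + t, 2 * b - c + t))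
    ?_ ?_ ?_ ?_ ?_
  · rintro ⟨k, l⟩ h
    simp only [Finset.mem_filter, Finset.mem_product, Finset.mem_range] at h ⊢
    omega
  · rintro t h
    simp only [Finset.mem_filter, Finset.mem_product, Finset.mem_range] at h ⊢
    omega
  · rintro ⟨k, l⟩ h
    simp only [Finset.mem_filter, Finset.mem_product, Finset.mem_range] at h ⊢
    simp only [Prod.mk.injEq]
    omega
  · rintro t h
    simp
  · rintro ⟨k, l⟩ h
    simp only [Finset.mem_filter, Finset.mem_product, Finset.mem_range] at h ⊢
    congr 1
    omega

/-! ### reduced words -/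

def Red (x : List (Σ i, G i)) : Prop :=
  (∀ s ∈ x, s.2 ≠ 1) ∧ x.IsChain fun s t => s.1 ≠ t.1

def lprod (x : List (Σ i, G i)) : Monoid.CoprodI G :=
  (x.map fun s => Monoid.CoprodI.of s.2).prod

def linv (x : List (Σ i, G i)) : List (Σ i, G i) :=
  (x.map fun s => (⟨s.1, s.2⁻¹⟩ : Σ i, G i)).reverse

def phiW (φ : ∀ i, G i → ℂ) (x : List (Σ i, G i)) : ℂ := (x.map fun s => φ s.1 s.2).prod

theorem lprod_append (x y : List (Σ i, G i)) : lprod (x ++ y) = lprod x * lprod y := by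
  simp [lprod]

theorem lprod_cons (s : Σ i, G i) (y : List (Σ i, G i)) :
    lprod (s :: y) = Monoid.CoprodI.of s.2 * lprod y := by
  simp [lprod]

theorem lprod_linv (x : List (Σ i, G i)) : lprod (linv x) = (lprod x)⁻¹ := by
  induction x with
  | nil => simp [lprod, linv]
  | cons s x ih =>
    have : linv (s :: x) = linv x ++ [⟨s.1, s.2⁻¹⟩] := by simp [linv]
    rw [this, lprod_append, ih, lprod_cons, lprod_cons]
    simp [lprod]

theorem Red.linv {x : List (Σ i, G i)} (h : Red x) : Red (linv x) := by
  refine ⟨?_, ?_⟩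
  · intro s hs
    simp only [_root_.linv, List.mem_reverse, List.mem_map] at hs
    obtain ⟨t, ht, rfl⟩ := hs
    simpa using h.1 t ht
  · rw [_root_.linv, List.isChain_reverse, List.isChain_map]
    exact h.2.imp fun s t h => h.symm

theorem Red.tail {s : Σ i, G i} {x : List (Σ i, G i)} (h : Red (s :: x)) : Red x :=
  ⟨fun t ht => h.1 t (by simp [ht]), h.2.tail⟩

theorem Red.drop {x : List (Σ i, G i)} (h : Red x) (m : ℕ) : Red (x.drop m) :=
  ⟨fun t ht => h.1 t (List.mem_of_mem_drop ht), h.2.drop m⟩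

theorem phiW_append (φ : ∀ i, G i → ℂ) (x y : List (Σ i, G i)) :
    phiW φ (x ++ y) = phiW φ x * phiW φ y := by simp [phiW]

theorem phiW_cons (φ : ∀ i, G i → ℂ) (s) (y : List (Σ i, G i)) :
    phiW φ (s :: y) = φ s.1 s.2 * phiW φ y := by simp [phiW]

theorem linv_cons (s) (x : List (Σ i, G i)) : linv (s :: x) = linv x ++ [⟨s.1, s.2⁻¹⟩] := by
  simp [linv]

theorem linv_length (x : List (Σ i, G i)) : (linv x).length = x.length := by simp [linv]

theorem kL_cons (q : (Σ i, G i) → (Σ i, G i) → ℂ) (n : ℕ) (s) (x : List (Σ i, G i)) :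
    kL q (n + 1) (s :: x) = kL q n x := by simp [kL]

theorem kR_cons (q : (Σ i, G i) → (Σ i, G i) → ℂ) (n : ℕ) (s) (x : List (Σ i, G i)) :
    kR q (n + 1) (s :: x) = kR q n x := by simp [kR]

theorem kap_cons_same (q : (Σ i, G i) → (Σ i, G i) → ℂ) (n : ℕ) (s) (x y : List (Σ i, G i)) :
    kap q (n + 1) (s :: x) (s :: y) = kap q n x y := by
  have : kW (n + 1) (s :: x) (s :: y) = kW n x y := by
    have key : ((kV (n + 1) (s :: x)).isSome ∧ kV (n + 1) (s :: x) = kV (n + 1) (s :: y)) ↔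
        ((kV n x).isSome ∧ kV n x = kV n y) := by
      unfold kV
      simp only [List.getElem?_cons_succ, List.take_succ_cons]
      rcases x[n]? with _ | a <;> rcases y[n]? with _ | b <;> simp
    unfold kW
    by_cases h : ((kV n x).isSome ∧ kV n x = kV n y)
    · rw [if_pos h, if_pos (key.2 h)]
    · rw [if_neg h, if_neg (fun h' => h (key.1 h'))]
  simp [kap, this, kL_cons, kR_cons]

theorem kap_cons_ne (q : (Σ i, G i) → (Σ i, G i) → ℂ) (n : ℕ) {s t} (h : s ≠ t)
    (x y : List (Σ i, G i)) :
    kap q (n + 1) (s :: x) (t :: y) = kL q n x * kR q n y := by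
  have : kW (n + 1) (s :: x) (t :: y) = 0 := by
    unfold kW kV
    simp only [List.getElem?_cons_succ, List.take_succ_cons]
    refine if_neg ?_
    rcases x[n]? with _ | a <;> rcases y[n]? with _ | b <;> simp [h]
  simp [kap, this, kL_cons, kR_cons]

theorem kap_zero_same (q : (Σ i, G i) → (Σ i, G i) → ℂ) {s t} (h : s.1 = t.1)
    (x y : List (Σ i, G i)) :
    kap q 0 (s :: x) (t :: y) = q s t := by
  simp [kap, kW, kV, h, oQ]

theorem kap_zero_ne (q : (Σ i, G i) → (Σ i, G i) → ℂ) {s t} (h : s.1 ≠ t.1)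
    (x y : List (Σ i, G i)) :
    kap q 0 (s :: x) (t :: y) = q s (sone s) * q (sone t) t := by
  simp [kap, kW, kV, h, kL, kR]

theorem kap_nil_right (q : (Σ i, G i) → (Σ i, G i) → ℂ) (n) (x : List (Σ i, G i)) :
    kap q n x [] = kL q n x := by
  have : kW n x [] = 0 := by
    unfold kW kV
    rcases x[n]? with _ | a <;> simp
  simp [kap, this, kR]

theorem kap_nil_left (q : (Σ i, G i) → (Σ i, G i) → ℂ) (n) (x : List (Σ i, G i)) :
    kap q n [] x = kR q n x := by
  have : kW n [] x = 0 := by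
    unfold kW kV
    rcases x[n]? with _ | a <;> simp
  simp [kap, this, kL]

theorem prod_kL {q : (Σ i, G i) → (Σ i, G i) → ℂ} {φ : ∀ i, G i → ℂ}
    (hq : ∀ i a b, q ⟨i, a⟩ ⟨i, b⟩ = φ i (b⁻¹ * a)) (x : List (Σ i, G i)) (M : ℕ)
    (hM : x.length ≤ M) : ∏ n ∈ Finset.range M, kL q n x = phiW φ x := by
  induction x generalizing M with
  | nil => simp [kL, phiW]
  | cons s x ih =>
    obtain ⟨M, rfl⟩ : ∃ M', M = M' + 1 := ⟨M - 1, by simp at hM; omega⟩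
    rw [Finset.prod_range_succ']
    simp only [kL_cons]
    rw [ih M (by simpa using hM), phiW_cons, mul_comm]
    congr 1
    obtain ⟨i, a⟩ := s
    simp [kL, sone, hq]

theorem prod_kR {q : (Σ i, G i) → (Σ i, G i) → ℂ} {φ : ∀ i, G i → ℂ}
    (hq : ∀ i a b, q ⟨i, a⟩ ⟨i, b⟩ = φ i (b⁻¹ * a)) (x : List (Σ i, G i)) (M : ℕ)
    (hM : x.length ≤ M) : ∏ n ∈ Finset.range M, kR q n x = phiW φ (linv x) := by
  induction x generalizing M with
  | nil => simp [kR, phiW, linv]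
  | cons s x ih =>
    obtain ⟨M, rfl⟩ : ∃ M', M = M' + 1 := ⟨M - 1, by simp at hM; omega⟩
    rw [Finset.prod_range_succ']
    simp only [kR_cons]
    rw [ih M (by simpa using hM), linv_cons, phiW_append]
    congr 1
    obtain ⟨i, a⟩ := s
    simp [kR, sone, hq, phiW]

theorem red_join {x y : List (Σ i, G i)} {s t : Σ i, G i} (hx : Red (s :: x)) (hy : Red (t :: y))
    (h : s.1 ≠ t.1) : Red (linv (t :: y) ++ s :: x) := by
  refine ⟨?_, ?_⟩
  · intro z hz
    rcases List.mem_append.1 hz with hz | hz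
    · exact hy.linv.1 z hz
    · exact hx.1 z hz
  · rw [List.isChain_append]
    refine ⟨hy.linv.2, hx.2, ?_⟩
    intro a ha b hb
    rw [linv_cons] at ha
    simp at ha hb
    subst ha hb
    exact h.symm

theorem red_replace {i} {a c : G i} {x : List (Σ i, G i)} (hx : Red (⟨i, a⟩ :: x)) (hc : c ≠ 1) :
    Red (⟨i, c⟩ :: x) := by
  refine ⟨?_, ?_⟩
  · intro z hz
    rcases List.mem_cons.1 hz with rfl | hz
    · exact hc
    · exact hx.1 z (by simp [hz])
  · have := hx.2
    rw [List.isChain_cons] at this ⊢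
    exact this

theorem red_join_same {x y : List (Σ i, G i)} {i} {a b : G i} (hx : Red (⟨i, a⟩ :: x))
    (hy : Red (⟨i, b⟩ :: y)) (h : a ≠ b) : Red (linv y ++ ⟨i, b⁻¹ * a⟩ :: x) := by
  have hc : b⁻¹ * a ≠ 1 := by
    intro h'
    exact h (inv_mul_eq_one.1 h').symm
  have hx' := red_replace hx hc
  cases y with
  | nil => simpa [linv] using hx'
  | cons t y =>
    refine red_join hx' hy.tail ?_
    have := hy.2
    rw [List.isChain_cons] at this
    exact this.1 t (by simp)

theorem quot_word (x y : List (Σ i, G i)) (hx : Red x) (hy : Red y) :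
    ∃ w, Red w ∧ lprod w = (lprod y)⁻¹ * lprod x ∧
      2 * w.length + 2 * cp (enc x) (enc y) = 2 * x.length + 2 * y.length ∧
      ∀ (q : (Σ i, G i) → (Σ i, G i) → ℂ) (φ : ∀ i, G i → ℂ),
        (∀ i a b, q ⟨i, a⟩ ⟨i, b⟩ = φ i (b⁻¹ * a)) → (∀ i, φ i 1 = 1) →
        ∀ M, x.length ≤ M → y.length ≤ M →
          ∏ n ∈ Finset.range M, kap q n x y = phiW φ w := by
  induction x generalizing y with
  | nil =>
    refine ⟨linv y, hy.linv, by rw [lprod_linv]; simp [lprod], by simp [enc, cp, linv_length], ?_⟩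
    intro q φ hq h1 M _ hM
    simp only [kap_nil_left]
    exact prod_kR hq y M hM
  | cons s x ih =>
    cases y with
    | nil =>
      refine ⟨s :: x, hx, by simp [lprod], by simp [enc, cp], ?_⟩
      intro q φ hq h1 M hM _
      simp only [kap_nil_right]
      exact prod_kL hq _ M hM
    | cons t y =>
      by_cases hst : s = t
      · subst hst
        obtain ⟨w, hw, h1, h2, h3⟩ := ih y hx.tail hy.tail
        refine ⟨w, hw, by rw [h1, lprod_cons, lprod_cons]; group, ?_, ?_⟩
        · simp [enc, cp]; omega
        · intro q φ hq ho M hM hM'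
          obtain ⟨M, rfl⟩ : ∃ M', M = M' + 1 := ⟨M - 1, by simp at hM; omega⟩
          rw [Finset.prod_range_succ']
          simp only [kap_cons_same]
          rw [h3 q φ hq ho M (by simpa using hM) (by simpa using hM'), kap_zero_same q rfl]
          obtain ⟨i, a⟩ := s
          simp [hq, ho]
      by_cases hi : s.1 = t.1
      · obtain ⟨i, a⟩ := s
        obtain ⟨j, b⟩ := t
        obtain rfl : i = j := hi
        have hab : a ≠ b := fun h => hst (by rw [h])
        refine ⟨linv y ++ ⟨i, b⁻¹ * a⟩ :: x, red_join_same hx hy hab, ?_, ?_, ?_⟩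
        · rw [lprod_append, lprod_cons, lprod_cons, lprod_cons, lprod_linv]
          simp [mul_assoc]
        · simp [enc, cp, linv_length, hab]; omega
        · intro q φ hq ho M hM hM'
          obtain ⟨M, rfl⟩ : ∃ M', M = M' + 1 := ⟨M - 1, by simp at hM; omega⟩
          rw [Finset.prod_range_succ']
          simp only [kap_cons_ne _ _ hst]
          rw [Finset.prod_mul_distrib, prod_kL hq x M (by simpa using hM),
            prod_kR hq y M (by simpa using hM'),
            kap_zero_same q (s := ⟨i, a⟩) (t := ⟨i, b⟩) rfl, hq, phiW_append, phiW_cons]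
          ring
      · refine ⟨linv (t :: y) ++ s :: x, red_join hx hy hi, ?_, ?_, ?_⟩
        · rw [lprod_append, lprod_linv]
        · simp [enc, cp, linv_length, hi]; omega
        · intro q φ hq ho M hM hM'
          obtain ⟨M, rfl⟩ : ∃ M', M = M' + 1 := ⟨M - 1, by simp at hM; omega⟩
          rw [Finset.prod_range_succ']
          simp only [kap_cons_ne _ _ hst]
          rw [Finset.prod_mul_distrib, prod_kL hq x M (by simpa using hM),
            prod_kR hq y M (by simpa using hM'), kap_zero_ne q hi, phiW_append, phiW_cons,
            linv_cons, phiW_append]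
          obtain ⟨i, a⟩ := s
          obtain ⟨j, b⟩ := t
          simp [sone, hq, phiW]
          ring

end Words

/-! ## Analytic part -/

theorem perturb {Z H : Type} [NormedAddCommGroup H] [InnerProductSpace ℂ H] (α β : Z → H) (c : ℝ)
    (hc : 1 ≤ c) (h1 : ∀ s, ‖α s‖ ≤ c) (h2 : ∀ s, ‖β s‖ ≤ c)
    (h3 : ∀ s, (inner ℂ (α s) (β s) : ℂ) = 1) :
    ∃ u : Z → H, (∀ s, ‖u s‖ = 1) ∧
      SB (fun s t => (inner ℂ (α s) (β t) : ℂ) - inner ℂ (u s) (u t))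
        ((c - 1) * c + 1 * (√(2 * c ^ 2 - 2) + (c - 1))) := by
  have hge : ∀ s, 1 ≤ ‖α s‖ * c := by
    intro s
    have := norm_inner_le_norm (𝕜 := ℂ) (α s) (β s)
    rw [h3, norm_one] at this
    exact this.trans (mul_le_mul_of_nonneg_left (h2 s) (norm_nonneg _))
  have hpos : ∀ s, 0 < ‖α s‖ := by
    intro s
    have hs := hge s
    by_contra h
    have h0 : ‖α s‖ = 0 := le_antisymm (not_lt.1 h) (norm_nonneg _)
    rw [h0] at hs
    linarith
  let u : Z → H := fun s => ((‖α s‖⁻¹ : ℝ) : ℂ) • α s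
  have hu : ∀ s, ‖u s‖ = 1 := by
    intro s
    simp only [u, norm_smul, Complex.norm_real, norm_inv, norm_norm]
    exact inv_mul_cancel₀ (hpos s).ne'
  have hau : ∀ s, ‖α s - u s‖ ≤ c - 1 := by
    intro s
    have e : α s - u s = ((1 - ‖α s‖⁻¹ : ℝ) : ℂ) • α s := by
      simp only [u]; push_cast; rw [sub_smul, one_smul]
    rw [e, norm_smul, Complex.norm_real, Real.norm_eq_abs]
    have : |1 - ‖α s‖⁻¹| * ‖α s‖ = |‖α s‖ - 1| := by
      conv_lhs => rw [← abs_of_pos (hpos s), ← abs_mul]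
      congr 1
      have := (hpos s).ne'
      rw [abs_of_pos (hpos s)]
      field_simp
    rw [this, abs_le]
    constructor
    · nlinarith [hge s, h1 s, hpos s]
    · linarith [h1 s]
  have hab : ∀ s, ‖β s - α s‖ ≤ √(2 * c ^ 2 - 2) := by
    intro s
    apply Real.le_sqrt_of_sq_le
    rw [@norm_sub_sq ℂ]
    have : (inner ℂ (β s) (α s) : ℂ) = 1 := by rw [← inner_conj_symm, h3]; simp
    rw [this]
    have e1 : ‖α s‖ ^ 2 ≤ c ^ 2 := by gcongr; exact h1 s
    have e2 : ‖β s‖ ^ 2 ≤ c ^ 2 := by gcongr; exact h2 s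
    simp
    linarith
  have hbu : ∀ s, ‖β s - u s‖ ≤ √(2 * c ^ 2 - 2) + (c - 1) := by
    intro s
    calc ‖β s - u s‖ = ‖(β s - α s) + (α s - u s)‖ := by congr 1; abel
      _ ≤ _ := (norm_add_le _ _).trans (add_le_add (hab s) (hau s))
  refine ⟨u, hu, ?_⟩
  have k1 := SB.of_vec (κ := fun s t => (inner ℂ (α s - u s) (β t) : ℂ)) (fun s => α s - u s) β
    (c - 1) c (by linarith) (by linarith) hau h2 (fun _ _ => rfl)
  have k2 := SB.of_vec (κ := fun s t => (inner ℂ (u s) (β t - u t) : ℂ)) u (fun s => β s - u s)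
    1 (√(2 * c ^ 2 - 2) + (c - 1)) (by linarith) (by have := Real.sqrt_nonneg (2 * c ^ 2 - 2); linarith) (fun s => (hu s).le) hbu (fun _ _ => rfl)
  refine (k1.add k2).congr fun s t => ?_
  simp only [inner_sub_left, inner_sub_right]
  ring

theorem exists_c (δ : ℝ) (hδ : 0 < δ) :
    ∃ c : ℝ, 1 < c ∧ c ^ 2 ≤ 2 ∧ (c - 1) * c + 1 * (√(2 * c ^ 2 - 2) + (c - 1)) ≤ δ := by
  have hcont : Continuous fun c : ℝ => (c - 1) * c + 1 * (√(2 * c ^ 2 - 2) + (c - 1)) := by fun_prop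
  have h1 := (hcont.tendsto 1).mono_left (nhdsWithin_le_nhds (s := Set.Ioi 1))
  have h2 : Filter.Tendsto (fun c : ℝ => c ^ 2) (nhdsWithin 1 (Set.Ioi 1)) (nhds (1 ^ 2)) :=
    ((continuous_pow 2).tendsto 1).mono_left nhdsWithin_le_nhds
  have e1 := h1.eventually_lt_const (u := δ) (by norm_num; exact hδ)
  have e2 := h2.eventually_lt_const (u := 2) (by norm_num)
  obtain ⟨c, hc⟩ := ((e1.and e2).and self_mem_nhdsWithin).exists
  exact ⟨c, hc.2, hc.1.2.le, hc.1.1.le⟩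

theorem sb_of_cb {G : Type} [Group G] {φ : G → ℂ} {C : ℝ} (h : HasCBNormBound φ C) :
    SB (fun g h => φ (h⁻¹ * g)) C := by
  obtain ⟨H, i1, i2, α, β, Ca, Cb, h1, h2, h3, h4⟩ := h
  exact (SB.of_vec α β Ca Cb ((norm_nonneg _).trans (h1 1)) ((norm_nonneg _).trans (h2 1)) h1 h2
    h4).mono h3

theorem cb_of_sb {G : Type} [Group G] {φ : G → ℂ} {C : ℝ}
    (h : SB (fun g h => φ (h⁻¹ * g)) C) : HasCBNormBound φ C := by
  obtain ⟨h0, H, i1, i2, α, β, h1, h2, h3⟩ := h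
  refine ⟨H, i1, i2, α, β, √C, √C, fun g => Real.le_sqrt_of_sq_le (h1 g),
    fun g => Real.le_sqrt_of_sq_le (h2 g), ?_, h3⟩
  rw [Real.mul_self_sqrt h0]

theorem wa_normalized {G : Type} [Group G] (h : WeaklyAmenableCH1 G) (S : Finset G) (η : ℝ)
    (hη : 0 < η) : ∃ φ : G → ℂ, (Function.support φ).Finite ∧ φ 1 = 1 ∧
      SB (fun g h => φ (h⁻¹ * g)) (1 + η) ∧ ∀ g ∈ S, ‖φ g - 1‖ < η := by
  classical
  set e := min (η / 8) (1 / 8) with he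
  have e1 : e ≤ η / 8 := min_le_left _ _
  have e2 : e ≤ 1 / 8 := min_le_right _ _
  have e0 : 0 < e := lt_min (by linarith) (by norm_num)
  obtain ⟨φ, hf, hcb, hS⟩ := h (insert 1 S) e e0
  have h1 := hS 1 (by simp)
  have hn : 1 - e < ‖φ 1‖ := by
    have := norm_sub_norm_le (1 : ℂ) (φ 1)
    rw [norm_sub_rev, norm_one] at this
    linarith
  have hn0 : 0 < ‖φ 1‖ := by linarith
  have hne : φ 1 ≠ 0 := norm_pos_iff.1 hn0
  refine ⟨fun g => (φ 1)⁻¹ * φ g, ?_, inv_mul_cancel₀ hne, ?_, ?_⟩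
  · refine hf.subset fun g hg => ?_
    simp only [Function.mem_support] at hg ⊢
    exact right_ne_zero_of_mul hg
  · refine ((sb_of_cb hcb).smul (φ 1)⁻¹).mono ?_
    rw [norm_inv, inv_mul_le_iff₀ hn0]
    nlinarith
  · intro g hg
    have h2 := hS g (by simp [hg])
    have : (φ 1)⁻¹ * φ g - 1 = (φ 1)⁻¹ * ((φ g - 1) - (φ 1 - 1)) := by
      field_simp; ring
    rw [this, norm_mul, norm_inv, inv_mul_lt_iff₀ hn0]
    have := norm_sub_le (φ g - 1) (φ 1 - 1)
    nlinarith

theorem sigma_vec {ι : Type} {G : ι → Type} (k : ∀ i, G i → G i → ℂ) (C : ℝ)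
    (h : ∀ i, SB (k i) C) :
    ∃ (H : Type) (_ : NormedAddCommGroup H) (_ : InnerProductSpace ℂ H)
      (α β : (Σ i, G i) → H), (∀ s, ‖α s‖ ^ 2 ≤ C) ∧ (∀ s, ‖β s‖ ^ 2 ≤ C) ∧
      ∀ i a b, inner ℂ (α ⟨i, a⟩) (β ⟨i, b⟩) = k i a b := by
  classical
  choose H i1 i2 α β h1 h2 h3 using fun i => (h i).2
  refine ⟨lp H 2, inferInstance, inferInstance, fun s => lp.single 2 s.1 (α s.1 s.2),
    fun s => lp.single 2 s.1 (β s.1 s.2), ?_, ?_, ?_⟩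
  · intro s
    rw [lp.norm_single (by norm_num)]
    exact h1 _ _
  · intro s
    rw [lp.norm_single (by norm_num)]
    exact h2 _ _
  · intro i a b
    rw [lp.inner_single_left]
    simp [h3]

theorem norm_prod_sub_one (l : List ℂ) (η : ℝ) (hη : η ≤ 1) (h : ∀ z ∈ l, ‖z - 1‖ ≤ η) :
    ‖l.prod - 1‖ ≤ (2 ^ l.length - 1) * η := by
  induction l with
  | nil => simp
  | cons z l ih =>
    have hz := h z (by simp)
    have hl := ih fun w hw => h w (by simp [hw])
    have hz2 : ‖z‖ ≤ 2 := by
      have := norm_add_le (z - 1) 1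
      simp at this
      linarith
    have e : (z :: l).prod - 1 = z * (l.prod - 1) + (z - 1) := by simp; ring
    rw [e]
    have := norm_add_le (z * (l.prod - 1)) (z - 1)
    rw [norm_mul] at this
    have h2 : ‖z‖ * ‖l.prod - 1‖ ≤ 2 * ((2 ^ l.length - 1) * η) :=
      mul_le_mul hz2 hl (norm_nonneg _) (by norm_num)
    simp only [List.length_cons, pow_succ]
    linarith

/-- the radial coefficient -/
noncomputable def coef (r : ℝ) (M D : ℕ) : ℝ :=
  (1 - r ^ 2) * ∑ t ∈ Finset.range M, if D + 2 * t < M then r ^ (D + 2 * t) else 0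

theorem coef_tel (r : ℝ) (M D : ℕ) :
    (1 - r ^ 2) * ∑ t ∈ Finset.range M, r ^ (D + 2 * t) = r ^ D - r ^ (D + 2 * M) := by
  induction M with
  | zero => simp
  | succ M ih =>
    rw [Finset.sum_range_succ, mul_add, ih]
    ring

theorem coef_le (r : ℝ) (hr0 : 0 < r) (hr : r < 1) (M D : ℕ) : coef r M D ≤ 1 := by
  have h1 : 0 ≤ 1 - r ^ 2 := by nlinarith
  have : coef r M D ≤ (1 - r ^ 2) * ∑ t ∈ Finset.range M, r ^ (D + 2 * t) := by
    unfold coef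
    gcongr
    split_ifs
    · exact le_rfl
    · positivity
  rw [coef_tel] at this
  have h2 : r ^ D ≤ 1 := pow_le_one₀ hr0.le hr.le
  have h3 : 0 < r ^ (D + 2 * M) := by positivity
  linarith

theorem coef_nonneg (r : ℝ) (hr0 : 0 < r) (hr : r < 1) (M D : ℕ) : 0 ≤ coef r M D := by
  have h1 : 0 ≤ 1 - r ^ 2 := by nlinarith
  refine mul_nonneg h1 (Finset.sum_nonneg fun t _ => ?_)
  split_ifs <;> positivity

theorem coef_ge (r : ℝ) (hr0 : 0 < r) (hr : r < 1) (M D : ℕ) :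
    r ^ D - (M + 1) * r ^ M ≤ coef r M D := by
  have h1 : 0 ≤ 1 - r ^ 2 := by nlinarith
  have : (1 - r ^ 2) * ∑ t ∈ Finset.range M, (r ^ (D + 2 * t) - r ^ M) ≤ coef r M D := by
    unfold coef
    gcongr with t ht
    split_ifs with h
    · have : 0 < r ^ M := by positivity
      linarith
    · have := pow_le_pow_of_le_one hr0.le hr.le (not_lt.1 h)
      linarith
  rw [Finset.sum_sub_distrib, mul_sub, coef_tel] at this
  simp only [Finset.sum_const, Finset.card_range, nsmul_eq_mul] at this
  have h2 : r ^ (D + 2 * M) ≤ r ^ M := pow_le_pow_of_le_one hr0.le hr.le (by omega)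
  have h3 : (1 - r ^ 2) * (M * r ^ M) ≤ 1 * (M * r ^ M) := by
    gcongr
    nlinarith
  linarith

theorem coef_zero (r : ℝ) (M D : ℕ) (h : M ≤ D) : coef r M D = 0 := by
  unfold coef
  rw [Finset.sum_eq_zero, mul_zero]
  intro t _
  rw [if_neg (by omega)]

/-! ## Assembly -/

section Assembly

set_option linter.unusedSectionVars false

variable {ι : Type} {G : ι → Type} [∀ i, Group (G i)]

noncomputable def KM (q : (Σ i, G i) → (Σ i, G i) → ℂ) (M : ℕ) (p p' : List (Σ i, G i) × ℕ) : ℂ :=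
  ∏ n ∈ Finset.range M, kap q n (suf p) (suf p')

open Classical in
noncomputable def TT (p p' : List (Σ i, G i) × ℕ) : ℂ := if anc p = anc p' then 1 else 0

noncomputable def FF (q : (Σ i, G i) → (Σ i, G i) → ℂ) (r : ℝ) (M : ℕ) (x y : List (Σ i, G i)) : ℂ :=
  ∑ k ∈ Finset.range M, ∑ l ∈ Finset.range M,
    if k + l < M then (((1 - r ^ 2) * r ^ (k + l) : ℝ) : ℂ) * (TT (x, k) (y, l) * KM q M (x, k) (y, l))
      else 0

theorem FF_sb {q : (Σ i, G i) → (Σ i, G i) → ℂ} (hq : SB q 2) {H : Type} [NormedAddCommGroup H]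
    [InnerProductSpace ℂ H] (u : (Σ i, G i) → H) (hu : ∀ s, ‖u s‖ = 1) (δ : ℝ)
    (hd : SB (fun s t => q s t - inner ℂ (u s) (u t)) δ) (r : ℝ) (hr0 : 0 < r) (hr : r < 1) (M : ℕ) :
    SB (FF q r M) (M * (M * (1 * (1 * (M * 10 ^ (M - 1) * (9 * δ))))) + 1 + M * (M * (r ^ M * 1))) := by
  classical
  set q' : (Σ i, G i) → (Σ i, G i) → ℂ := fun s t => inner ℂ (u s) (u t) with hq'
  have hr2 : 0 ≤ 1 - r ^ 2 := by nlinarith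
  have hq1 : ∀ s, q' s s = 1 := by
    intro s
    simp only [hq', inner_self_eq_norm_sq_to_K, hu]; simp
  have hq'2 : SB q' 2 :=
    SB.mono (C := 1) (Gram.sb zero_le_one ⟨H, inferInstance, inferInstance, u, fun _ _ => rfl⟩
      (by intro s; rw [hq1]; simp)) (by norm_num)
  have hTg : Gram (TT (G := G)) := (Gram.eq (anc (G := G))).congr fun p p' => by
    by_cases h : anc p = anc p' <;> simp [TT, h]
  have hT1 : SB (TT (G := G)) 1 := hTg.sb zero_le_one (by intro p; simp [TT])
  have hK'g : Gram (KM q' M) :=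
    (Gram.prod M fun n => kap_gram (q := q') u hu (fun _ _ => rfl) n).comp suf
  have hK'1 : ∀ p, KM q' M p p = 1 := by
    intro p
    exact Finset.prod_eq_one fun n _ => kap_diag hq1 n _
  have hP'g : Gram (fun p p' => TT p p' * KM q' M p p') := hTg.mul hK'g
  have hP'1 : SB (fun p p' => TT p p' * KM q' M p p') 1 :=
    hP'g.sb zero_le_one (by intro p; simp [hK'1, TT])
  have hKd : SB (fun p p' => KM q M p p' - KM q' M p p') (M * 10 ^ (M - 1) * (9 * δ)) :=
    (SB.prod_sub M (kap_sb hq) (kap_sb hq'2) (kap_sub hq hq'2 hd)).comp suf suf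
  have hE := hT1.mul hKd
  have hco : ∀ n, ‖(((1 - r ^ 2) * r ^ n : ℝ) : ℂ)‖ ≤ r ^ n := by
    intro n
    rw [Complex.norm_real, Real.norm_of_nonneg (by positivity)]
    have : 0 < r ^ n := by positivity
    nlinarith [mul_nonneg (sq_nonneg r) this.le]
  have hEnn := hE.1
  -- first part
  have A1 : SB (fun x y => ∑ k ∈ Finset.range M, ∑ l ∈ Finset.range M,
      if k + l < M then (((1 - r ^ 2) * r ^ (k + l) : ℝ) : ℂ) *
        (TT (x, k) (y, l) * (KM q M (x, k) (y, l) - KM q' M (x, k) (y, l))) else 0)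
      (M * (M * (1 * (1 * (M * 10 ^ (M - 1) * (9 * δ)))))) := by
    have : SB (fun x y => ∑ k ∈ Finset.range M, ∑ l ∈ Finset.range M,
      if k + l < M then (((1 - r ^ 2) * r ^ (k + l) : ℝ) : ℂ) *
        (TT (x, k) (y, l) * (KM q M (x, k) (y, l) - KM q' M (x, k) (y, l))) else 0)
        (∑ k ∈ Finset.range M, ∑ l ∈ Finset.range M, (1 * (1 * (M * 10 ^ (M - 1) * (9 * δ))))) := by
      refine SB.sum _ fun k _ => SB.sum _ fun l _ => ?_
      split_ifs
      · refine ((hE.comp (fun x => (x, k)) (fun y => (y, l))).smul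
          (((1 - r ^ 2) * r ^ (k + l) : ℝ) : ℂ)).mono ?_
        exact mul_le_mul_of_nonneg_right ((hco _).trans (pow_le_one₀ hr0.le hr.le)) hEnn
      · exact (SB.const 0).mono (by simpa using hEnn)
    simpa using this
  have A3 : SB (fun x y => ∑ k ∈ Finset.range M, ∑ l ∈ Finset.range M,
      if k + l < M then 0 else (((1 - r ^ 2) * r ^ (k + l) : ℝ) : ℂ) *
        (TT (x, k) (y, l) * KM q' M (x, k) (y, l)))
      (M * (M * (r ^ M * 1))) := by
    have : SB (fun x y => ∑ k ∈ Finset.range M, ∑ l ∈ Finset.range M,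
      if k + l < M then 0 else (((1 - r ^ 2) * r ^ (k + l) : ℝ) : ℂ) *
        (TT (x, k) (y, l) * KM q' M (x, k) (y, l)))
        (∑ k ∈ Finset.range M, ∑ l ∈ Finset.range M, (r ^ M * 1)) := by
      refine SB.sum _ fun k _ => SB.sum _ fun l _ => ?_
      split_ifs with h
      · exact (SB.const 0).mono (by rw [norm_zero]; positivity)
      · refine ((hP'1.comp (fun x => (x, k)) (fun y => (y, l))).smul
          (((1 - r ^ 2) * r ^ (k + l) : ℝ) : ℂ)).mono ?_
        exact mul_le_mul_of_nonneg_right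
          ((hco _).trans (pow_le_pow_of_le_one hr0.le hr.le (not_lt.1 h))) zero_le_one
    simpa using this
  have A2 : SB (fun x y => ∑ k ∈ Finset.range M, ∑ l ∈ Finset.range M,
      (((1 - r ^ 2) * r ^ (k + l) : ℝ) : ℂ) * (TT (x, k) (y, l) * KM q' M (x, k) (y, l))) 1 := by
    have hc : ∀ k l : ℕ, (√(1 - r ^ 2) * r ^ k) * (√(1 - r ^ 2) * r ^ l) = (1 - r ^ 2) * r ^ (k + l) := by
      intro k l
      calc _ = (√(1 - r ^ 2) * √(1 - r ^ 2)) * r ^ (k + l) := by ring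
        _ = _ := by rw [Real.mul_self_sqrt hr2]
    have hg := hP'g.weighted (fun k => √(1 - r ^ 2) * r ^ k) M
    simp only [hc] at hg
    refine hg.sb zero_le_one fun x => ?_
    have : ∀ k l, TT (x, k) (x, l) * KM q' M (x, k) (x, l) = if k = l then 1 else 0 := by
      intro k l
      by_cases h : k = l
      · subst h
        simp [hK'1, TT]
      · have : anc (x, k) ≠ anc (x, l) := by
          intro h'
          have := ((anc_eq_iff x x k l).1 h').1
          omega
        simp [TT, this, h]
    simp only [this]
    have e : (∑ k ∈ Finset.range M, ∑ l ∈ Finset.range M,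
        (((1 - r ^ 2) * r ^ (k + l) : ℝ) : ℂ) * (if k = l then 1 else 0)) =
        (((1 - r ^ 2) * ∑ t ∈ Finset.range M, r ^ (0 + 2 * t) : ℝ) : ℂ) := by
      rw [Finset.mul_sum, Complex.ofReal_sum]
      refine Finset.sum_congr rfl fun k hk => ?_
      simp only [mul_ite, mul_one, mul_zero, Finset.sum_ite_eq, hk, if_true]
      congr 3; ring
    rw [e, coef_tel, Complex.norm_real, Real.norm_eq_abs, abs_le]
    have h1 : r ^ (0 + 2 * M) ≤ 1 := pow_le_one₀ hr0.le hr.le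
    have h2 : 0 < r ^ (0 + 2 * M) := by positivity
    constructor <;> simp only [pow_zero] <;> linarith
  refine ((A1.add A2).sub A3).congr fun x y => ?_
  unfold FF
  simp only [← Finset.sum_add_distrib, ← Finset.sum_sub_distrib]
  refine Finset.sum_congr rfl fun k _ => Finset.sum_congr rfl fun l _ => ?_
  split_ifs <;> ring

theorem red_inj {x y : List (Σ i, G i)} (hx : Red x) (hy : Red y) (h : lprod x = lprod y) :
    x = y := by
  classical
  have := (Monoid.CoprodI.Word.equiv (M := G)).symm.injective
    (a₁ := ⟨x, hx.1, hx.2⟩) (a₂ := ⟨y, hy.1, hy.2⟩) h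
  exact congrArg Monoid.CoprodI.Word.toList this

open Classical in
noncomputable def wd (g : Monoid.CoprodI G) : List (Σ i, G i) :=
  (Monoid.CoprodI.Word.equiv (M := G) g).toList

theorem wd_red (g : Monoid.CoprodI G) : Red (wd g) := by
  classical
  exact ⟨(Monoid.CoprodI.Word.equiv (M := G) g).ne_one, (Monoid.CoprodI.Word.equiv (M := G) g).chain_ne⟩

theorem wd_prod (g : Monoid.CoprodI G) : lprod (wd g) = g := by
  classical
  exact (Monoid.CoprodI.Word.equiv (M := G)).symm_apply_apply g

noncomputable def PHI (φ : ∀ i, G i → ℂ) (r : ℝ) (M : ℕ) (g : Monoid.CoprodI G) : ℂ :=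
  (coef r M (2 * (wd g).length) : ℂ) * phiW φ (wd g)

theorem PHI_eq {q : (Σ i, G i) → (Σ i, G i) → ℂ} {φ : ∀ i, G i → ℂ}
    (hq : ∀ i a b, q ⟨i, a⟩ ⟨i, b⟩ = φ i (b⁻¹ * a)) (ho : ∀ i, φ i 1 = 1) (r : ℝ) (M : ℕ)
    (g h : Monoid.CoprodI G) : PHI φ r M (h⁻¹ * g) = FF q r M (wd g) (wd h) := by
  classical
  obtain ⟨w, hw, h1, h2, -⟩ := quot_word (wd g) (wd h) (wd_red g) (wd_red h)
  have hwd : wd (h⁻¹ * g) = w := by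
    refine red_inj (wd_red _) hw ?_
    rw [wd_prod, h1, wd_prod, wd_prod]
  unfold PHI
  rw [hwd]
  unfold coef
  rw [← anc_sum (wd g) (wd h) M r (2 * w.length) h2]
  unfold FF
  rw [Finset.mul_sum, Complex.ofReal_sum, Finset.sum_mul]
  refine Finset.sum_congr rfl fun k hk => ?_
  rw [Finset.mul_sum, Complex.ofReal_sum, Finset.sum_mul]
  refine Finset.sum_congr rfl fun l hl => ?_
  rw [Finset.mem_range] at hk hl
  by_cases hkl : k + l < M
  · rw [if_pos hkl, if_pos hkl]
    by_cases ha : anc (wd g, k) = anc (wd h, l)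
    · have hK : KM q M (wd g, k) (wd h, l) = phiW φ w := by
        obtain ⟨p, e1, e2⟩ := suf_spec _ _ _ _ ha
        obtain ⟨w', hw', h1', -, h3'⟩ := quot_word (suf (wd g, k)) (suf (wd h, l))
          ((wd_red g).drop _) ((wd_red h).drop _)
        have : w' = w := by
          refine red_inj hw' hw ?_
          rw [h1, h1']
          conv_rhs => rw [e1, e2, lprod_append, lprod_append]
          group
        subst this
        exact h3' q φ hq ho M ((suf_length _ _).trans hk.le) ((suf_length _ _).trans hl.le)
      rw [hK]
      simp [TT, ha]
    · simp [TT, ha]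
  · rw [if_neg hkl, if_neg hkl]
    simp

theorem PHI_support [Finite ι] (φ : ∀ i, G i → ℂ) (hφ : ∀ i, (Function.support (φ i)).Finite)
    (r : ℝ) (M : ℕ) : (Function.support (PHI φ r M)).Finite := by
  classical
  let S : Set (Σ i, G i) := ⋃ i, Sigma.mk i '' Function.support (φ i)
  have hS : S.Finite := Set.finite_iUnion fun i => (hφ i).image _
  have : Finite S := hS
  have hL : ((List.map (Subtype.val : S → _)) '' {l : List S | l.length < M}).Finite :=
    (List.finite_length_lt S M).image _
  refine Set.Finite.of_finite_image (f := wd) (hL.subset ?_) ?_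
  · rintro _ ⟨g, hg, rfl⟩
    rw [Function.mem_support, PHI] at hg
    have hlen : (wd g).length < M := by
      by_contra h
      exact hg (by rw [coef_zero _ _ _ (by omega)]; simp)
    have hmem : ∀ s ∈ wd g, s ∈ S := by
      intro s hs
      have h0 : phiW φ (wd g) ≠ 0 := right_ne_zero_of_mul hg
      refine Set.mem_iUnion.2 ⟨s.1, s.2, ?_, rfl⟩
      intro h
      exact h0 (List.prod_eq_zero (List.mem_map.2 ⟨s, hs, h⟩))
    refine ⟨(wd g).attach.map fun s => ⟨s.1, hmem s.1 s.2⟩, by simpa using hlen, ?_⟩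
    simp [List.map_map, Function.comp_def]
  · intro g _ h _ e
    rw [← wd_prod g, e, wd_prod]

theorem wa_coprodI [Finite ι] (hG : ∀ i, WeaklyAmenableCH1 (G i)) :
    WeaklyAmenableCH1 (Monoid.CoprodI G) := by
  classical
  intro S ε hε
  -- maximal length
  let L := S.sup fun g => (wd g).length
  have hL : ∀ g ∈ S, (wd g).length ≤ L := fun g hg => Finset.le_sup (f := fun g => (wd g).length) hg
  -- choose r
  obtain ⟨r, hr0, hr, hrL⟩ : ∃ r : ℝ, 0 < r ∧ r < 1 ∧ 1 - ε / 4 < r ^ (2 * L) := by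
    have h1 : Filter.Tendsto (fun r : ℝ => r ^ (2 * L)) (nhdsWithin 1 (Set.Iio 1)) (nhds (1 ^ (2 * L))) :=
      ((continuous_pow _).tendsto 1).mono_left nhdsWithin_le_nhds
    have h2 : Filter.Tendsto (fun r : ℝ => r) (nhdsWithin 1 (Set.Iio 1)) (nhds 1) := nhdsWithin_le_nhds
    have e1 := h1.eventually_const_lt (u := 1 - ε / 4) (by rw [one_pow]; linarith)
    have e2 := h2.eventually_const_lt (u := 0) (by norm_num)
    obtain ⟨r, hr⟩ := ((e1.and e2).and self_mem_nhdsWithin).exists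
    exact ⟨r, hr.1.2, hr.2, hr.1.1⟩
  -- choose M
  obtain ⟨M, hM⟩ : ∃ M : ℕ, ((M : ℝ) + 1) ^ 2 * r ^ M < ε / 4 := by
    have h1 := tendsto_pow_const_mul_const_pow_of_abs_lt_one 2 (r := r) (by rwa [abs_of_pos hr0])
    have h2 := (h1.eventually_lt_const (u := r * (ε / 4)) (by positivity)).and
      (Filter.eventually_ge_atTop 1)
    obtain ⟨N, hN, hN1⟩ := h2.exists
    obtain ⟨M, rfl⟩ : ∃ M, N = M + 1 := ⟨N - 1, by omega⟩
    refine ⟨M, ?_⟩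
    push_cast at hN
    rw [pow_succ r] at hN
    have : r * (((M : ℝ) + 1) ^ 2 * r ^ M) < r * (ε / 4) := by linarith
    exact lt_of_mul_lt_mul_left this hr0.le
  have hrM : 0 < r ^ M := by positivity
  -- choose δ
  obtain ⟨δ, hδ, hδM⟩ : ∃ δ : ℝ, 0 < δ ∧ (M : ℝ) * (M * (1 * (1 * (M * 10 ^ (M - 1) * (9 * δ))))) ≤ ε / 4 := by
    have hK : (0 : ℝ) < M * (M * (M * 10 ^ (M - 1) * 9)) + 1 := by positivity
    refine ⟨ε / 4 / (M * (M * (M * 10 ^ (M - 1) * 9)) + 1), by positivity, ?_⟩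
    have : (M : ℝ) * (M * (1 * (1 * (M * 10 ^ (M - 1) *
        (9 * (ε / 4 / (M * (M * (M * 10 ^ (M - 1) * 9)) + 1))))))) =
        (M * (M * (M * 10 ^ (M - 1) * 9))) * (ε / 4) / (M * (M * (M * 10 ^ (M - 1) * 9)) + 1) := by ring
    rw [this, div_le_iff₀ hK]
    nlinarith
  obtain ⟨c, hc1, hc2, hcδ⟩ := exists_c δ hδ
  -- choose φ
  let η := min (c ^ 2 - 1) (min 1 (ε / 4 / 2 ^ L))
  have hη0 : 0 < η := lt_min (by nlinarith) (lt_min one_pos (by positivity))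
  have hη1 : η ≤ c ^ 2 - 1 := min_le_left _ _
  have hη2 : η ≤ 1 := (min_le_right _ _).trans (min_le_left _ _)
  have hη3 : η ≤ ε / 4 / 2 ^ L := (min_le_right _ _).trans (min_le_right _ _)
  let SS : Finset (Σ i, G i) := S.biUnion fun g => (wd g).toFinset
  choose φ hφf hφ1 hφsb hφS using fun i => wa_normalized (hG i)
    (SS.preimage (Sigma.mk i) sigma_mk_injective.injOn) η hη0
  obtain ⟨H, i1, i2, α, β, ha, hb, hq⟩ := sigma_vec (fun i a b => φ i (b⁻¹ * a)) (c ^ 2)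
    (fun i => (hφsb i).mono (by linarith))
  have ha' : ∀ s, ‖α s‖ ≤ c := fun s => abs_le_of_sq_le_sq' (ha s) (by linarith) |>.2
  have hb' : ∀ s, ‖β s‖ ≤ c := fun s => abs_le_of_sq_le_sq' (hb s) (by linarith) |>.2
  obtain ⟨u, hu, hd⟩ := perturb α β c hc1.le ha' hb' (by rintro ⟨i, a⟩; rw [hq]; simp [hφ1])
  have hq2 : SB (fun s t => (inner ℂ (α s) (β t) : ℂ)) 2 :=
    ⟨by norm_num, H, i1, i2, α, β, fun s => (ha s).trans hc2, fun s => (hb s).trans hc2, fun _ _ => rfl⟩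
  have hF := FF_sb hq2 u hu δ (hd.mono hcδ) r hr0 hr M
  refine ⟨PHI φ r M, PHI_support φ hφf r M, ?_, ?_⟩
  · refine cb_of_sb (((hF.comp wd wd).congr fun g h => PHI_eq hq hφ1 r M g h).mono ?_)
    nlinarith
  · intro g hg
    have hp : ‖phiW φ (wd g) - 1‖ ≤ ε / 4 := by
      refine (norm_prod_sub_one _ η hη2 ?_).trans ?_
      · intro z hz
        obtain ⟨s, hs, rfl⟩ := List.mem_map.1 hz
        refine (hφS s.1 s.2 ?_).le
        rw [Finset.mem_preimage]
        exact Finset.mem_biUnion.2 ⟨g, hg, by simpa using hs⟩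
      · rw [List.length_map]
        have h2 : (2 : ℝ) ^ (wd g).length ≤ 2 ^ L := pow_le_pow_right₀ (by norm_num) (hL g hg)
        calc ((2 : ℝ) ^ (wd g).length - 1) * η ≤ 2 ^ L * η := by gcongr; linarith
          _ ≤ 2 ^ L * (ε / 4 / 2 ^ L) := by gcongr
          _ = ε / 4 := by field_simp
    have c1 := coef_le r hr0 hr M (2 * (wd g).length)
    have c0 := coef_nonneg r hr0 hr M (2 * (wd g).length)
    have c2 := coef_ge r hr0 hr M (2 * (wd g).length)
    have c3 : r ^ (2 * L) ≤ r ^ (2 * (wd g).length) :=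
      pow_le_pow_of_le_one hr0.le hr.le (by have := hL g hg; omega)
    have c4 : ((M : ℝ) + 1) * r ^ M ≤ ((M : ℝ) + 1) ^ 2 * r ^ M := by
      gcongr
      have : (0 : ℝ) ≤ M := by positivity
      nlinarith
    unfold PHI
    set a := coef r M (2 * (wd g).length)
    have e : (a : ℂ) * phiW φ (wd g) - 1 = a * (phiW φ (wd g) - 1) + ((a - 1 : ℝ) : ℂ) := by
      push_cast; ring
    rw [e]
    refine (norm_add_le _ _).trans_lt ?_
    rw [norm_mul, Complex.norm_real, Complex.norm_real, Real.norm_of_nonneg c0,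
      Real.norm_of_nonpos (by linarith)]
    have : a * ‖phiW φ (wd g) - 1‖ ≤ 1 * (ε / 4) := mul_le_mul c1 hp (norm_nonneg _) zero_le_one
    linarith

end Assembly

theorem wa_equiv {G K : Type} [Group G] [Group K] (e : G ≃* K) (h : WeaklyAmenableCH1 G) :
    WeaklyAmenableCH1 K := by
  classical
  intro S ε hε
  obtain ⟨φ, hf, hcb, hS⟩ := h (S.image e.symm) ε hε
  refine ⟨φ ∘ e.symm, ?_, ?_, ?_⟩
  · rw [Function.support_comp_eq_preimage]
    exact hf.preimage e.symm.injective.injOn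
  · refine cb_of_sb (((sb_of_cb hcb).comp e.symm e.symm).congr fun g h => ?_)
    simp
  · intro g hg
    exact hS _ (Finset.mem_image_of_mem _ hg)

def BF (A B : Type) : Bool → Type
  | true => A
  | false => B

instance (A B : Type) [Group A] [Group B] : ∀ b, Group (BF A B b)
  | true => inferInstanceAs (Group A)
  | false => inferInstanceAs (Group B)

def bHom (A B : Type) [Group A] [Group B] : ∀ b, BF A B b →* Monoid.Coprod A B
  | true => (Monoid.Coprod.inl : A →* Monoid.Coprod A B)
  | false => (Monoid.Coprod.inr : B →* Monoid.Coprod A B)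

def bEquiv (A B : Type) [Group A] [Group B] : Monoid.CoprodI (BF A B) ≃* Monoid.Coprod A B :=
  MonoidHom.toMulEquiv (Monoid.CoprodI.lift (bHom A B))
    (Monoid.Coprod.lift (Monoid.CoprodI.of (M := BF A B) (i := true) : A →* _)
      (Monoid.CoprodI.of (M := BF A B) (i := false) : B →* _))
    (by
      refine Monoid.CoprodI.ext_hom _ _ fun b => ?_
      cases b <;> ext a <;> simp [bHom] <;> rfl)
    (by
      refine Monoid.Coprod.hom_ext ?_ ?_
      · ext a
        exact Monoid.CoprodI.lift_of (bHom A B) (i := true) a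
      · ext a
        exact Monoid.CoprodI.lift_of (bHom A B) (i := false) a)

theorem stmt15 (A B : Type) [Group A] [Group B]
    (hA : WeaklyAmenableCH1 A) (hB : WeaklyAmenableCH1 B) :
    WeaklyAmenableCH1 (Monoid.Coprod A B) := by
  refine wa_equiv (bEquiv A B) (wa_coprodI ?_)
  rintro (_ | _)
  · exact hB
  · exact hA
end
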